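/- arXiv:1312.5701 — 2 statements merged into one kernel-verified Lean document; each statement's English description precedes it below -/
import Mathlib

section
/- Let g : ℕ → ℝ be essentially bounded, fix ϑ ∈ (1/3,1) and G ∈ (0,1), and set θ₀ = (3ϑ−1)/((1−G)ϑ+G+1). Assume that for every θ ∈ (θ₀, ϑ] and all constants 0 < c₁ < c₂ there exists C > 0 such that J_{w′,g}(M,h) ≤ C·M·h^{2−G} for all positive integers M, h with c₁·M^θ ≤ h ≤ c₂·M^θ. Then there exists G′ > 0, depending only on ϑ and G, such that for all constants 0 < c₁ < c₂ there exists C′ > 0 with J_{w′,g∗1}(N,H) ≤ C′·N·H^{2−3G′} for all positive integers N, H with c₁·N^ϑ ≤ H ≤ c₂·N^ϑ. -/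
/-- The restriction to `[-H,H]` of the unit step weight: `u_H(a) = 1` if `0 < a ≤ H`. -/
noncomputable def uH (H : ℕ) (a : ℤ) : ℝ := if 0 < a ∧ a ≤ (H : ℤ) then 1 else 0

/-- The Cesaro weight `C_H(a) = max(1 - |a|/H, 0)` (vanishing outside `[-H,H]`). -/
noncomputable def cesaroH (H : ℕ) (a : ℤ) : ℝ := max (1 - |(a : ℝ)| / (H : ℝ)) 0

/-- The weight `w′_H = C_H - u_H`. -/
noncomputable def wH' (H : ℕ) (a : ℤ) : ℝ := cesaroH H a - uH H a

/-- The weighted Selberg integral `J_{w′,f}(N,H) = Σ_{N<x≤2N} |Σ_{n≥1} w′_H(n-x) f(n)|²`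
(the weight `w′_H` vanishes outside `[-H,H]`, so the inner sum is over `1 ≤ n ≤ x+H`). -/
noncomputable def Jw' (f : ℕ → ℝ) (N H : ℕ) : ℝ :=
  ∑ x ∈ Finset.Ioc N (2 * N),
    (∑ n ∈ Finset.Icc 1 (x + H), wH' H ((n : ℤ) - (x : ℤ)) * f n) ^ 2

/-- `g` is essentially bounded: for every `ε > 0`, `g(n) ≪_ε n^ε`. -/
def EssBdd (g : ℕ → ℝ) : Prop :=
  ∀ ε : ℝ, 0 < ε → ∃ C : ℝ, 0 < C ∧ ∀ n : ℕ, 0 < n → |g n| ≤ C * (n : ℝ) ^ ε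

theorem wH'_eq (h : ℕ) (hh : 0 < h) (a : ℤ) :
    wH' h a = (max ((a : ℝ) + h) 0 - 2 * max (a : ℝ) 0 + max ((a : ℝ) - h) 0) / h
      - ((if 0 < a then (1 : ℝ) else 0) - (if 0 < a - (h : ℤ) then (1 : ℝ) else 0)) := by
  have hR : (0 : ℝ) < h := by exact_mod_cast hh
  have h1 : cesaroH h a =
      (max ((a : ℝ) + h) 0 - 2 * max (a : ℝ) 0 + max ((a : ℝ) - h) 0) / h := by
    have e : cesaroH h a = max ((h : ℝ) - |(a : ℝ)|) 0 / h := by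
      unfold cesaroH
      rw [← max_div_div_right hR.le, sub_div, div_self hR.ne', zero_div]
    rw [e]
    congr 1
    rcases le_total (0 : ℝ) a with ha | ha
    · rw [abs_of_nonneg ha, max_eq_left ha, max_eq_left (by linarith : (0 : ℝ) ≤ a + h)]
      rcases le_total (a : ℝ) h with hb | hb
      · rw [max_eq_left (by linarith), max_eq_right (by linarith)]; ring
      · rw [max_eq_right (by linarith), max_eq_left (by linarith)]; ring
    · rw [abs_of_nonpos ha, max_eq_right ha, max_eq_right (by linarith : (a : ℝ) - h ≤ 0)]
      rw [show (h : ℝ) - -a = a + h by ring]; ring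
  have h2 : uH h a = (if 0 < a then (1 : ℝ) else 0) - (if 0 < a - (h : ℤ) then (1 : ℝ) else 0) := by
    unfold uH
    split_ifs <;> first | omega | norm_num
  rw [wH', h1, h2]

theorem uH_eq (h : ℕ) (a : ℤ) :
    uH h a = (if 0 < a then (1 : ℝ) else 0) - (if 0 < a - (h : ℤ) then (1 : ℝ) else 0) := by
  unfold uH
  split_ifs <;> first | omega | norm_num

/-- Differences of unit steps are combinations of `w'` at the scales `h`, `2h`, `3h`. -/
theorem uH_sub_shift (h : ℕ) (hh : 0 < h) (a : ℤ) :
    uH h a - uH h (a - h) =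
      4 * wH' (2 * h) (a - h) + 2 * wH' (2 * h) (a - 2 * h) + 4 * wH' (2 * h) (a - 3 * h)
      - 3 * wH' (3 * h) (a - 2 * h)
      - wH' h a - 3 * wH' h (a - h) - 3 * wH' h (a - 2 * h) - 3 * wH' h (a - 3 * h)
      - wH' h (a - 4 * h) := by
  have hR : (h : ℝ) ≠ 0 := by positivity
  simp only [uH_eq, wH'_eq h hh, wH'_eq (2 * h) (by omega), wH'_eq (3 * h) (by omega)]
  push_cast
  set P : ℤ → ℝ := fun b => if 0 < b then 1 else 0 with hP
  set Q : ℝ → ℝ := fun b => max b 0 with hQ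
  have hP' : ∀ b : ℤ, (if 0 < b then (1 : ℝ) else 0) = P b := fun _ => rfl
  have hQ' : ∀ b : ℝ, max b 0 = Q b := fun _ => rfl
  simp only [hP', hQ']
  clear_value P Q
  field_simp
  ring_nf

theorem sum_second_difference (ρ : ℤ → ℝ) (k : ℕ) :
    ∑ i ∈ Finset.range k, ∑ j ∈ Finset.range k,
      (ρ ((i : ℤ) - j + 1) - 2 * ρ ((i : ℤ) - j) + ρ ((i : ℤ) - j - 1))
      = ρ k - 2 * ρ 0 + ρ (-k) := by
  have h1 : ∀ i : ℕ, ∑ j ∈ Finset.range k,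
      (ρ ((i : ℤ) - j + 1) - 2 * ρ ((i : ℤ) - j) + ρ ((i : ℤ) - j - 1))
      = (ρ ((i + 1 : ℕ) : ℤ) - ρ (((i + 1 : ℕ) : ℤ) - k)) - (ρ (i : ℤ) - ρ ((i : ℤ) - k)) := by
    intro i
    have := Finset.sum_range_sub' (fun j : ℕ => ρ ((i : ℤ) - j + 1) - ρ ((i : ℤ) - j)) k
    simp only [Nat.cast_zero, sub_zero] at this
    trans (ρ ((i : ℤ) + 1) - ρ (i : ℤ)) - (ρ ((i : ℤ) - k + 1) - ρ ((i : ℤ) - k))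
    · rw [← this]
      refine Finset.sum_congr rfl fun j _ => ?_
      push_cast
      rw [show (i : ℤ) - (j + 1) + 1 = i - j by ring, show (i : ℤ) - (j + 1) = i - j - 1 by ring]
      ring
    · push_cast
      rw [show (i : ℤ) + 1 - k = i - k + 1 by ring]
      ring
  rw [Finset.sum_congr rfl fun i _ => h1 i]
  rw [Finset.sum_range_sub (fun i : ℕ => ρ (i : ℤ) - ρ ((i : ℤ) - k))]
  simp
  ring

theorem mul_wH'_mul (h k : ℕ) (hh : 0 < h) (hk : 0 < k) (a : ℤ) :
    k * wH' (k * h) a = ∑ i ∈ Finset.range k, ∑ j ∈ Finset.range k,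
      (wH' h (a - ((i : ℤ) - j) * h) + (uH h (a - ((i : ℤ) - j) * h) - uH h (a - i * h))) := by
  have hR : (h : ℝ) ≠ 0 := by positivity
  have kR : (k : ℝ) ≠ 0 := by positivity
  have h1 := sum_second_difference (fun l => max ((a : ℝ) - l * h) 0 / h) k
  have h2 := Finset.sum_range_sub' (fun i : ℕ => if 0 < a - (i : ℤ) * h then (1 : ℝ) else 0) k
  have e : ∀ i j : ℕ, (wH' h (a - ((i : ℤ) - j) * h)
      + (uH h (a - ((i : ℤ) - j) * h) - uH h (a - i * h)))
      = (max ((a : ℝ) - ((i : ℤ) - j + 1 : ℤ) * h) 0 / h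
          - 2 * (max ((a : ℝ) - ((i : ℤ) - j : ℤ) * h) 0 / h)
          + max ((a : ℝ) - ((i : ℤ) - j - 1 : ℤ) * h) 0 / h)
        - ((if 0 < a - (i : ℤ) * h then (1 : ℝ) else 0)
          - (if 0 < a - ((i + 1 : ℕ) : ℤ) * h then (1 : ℝ) else 0)) := by
    intro i j
    rw [wH'_eq h hh, uH_eq, uH_eq]
    push_cast
    rw [show a - (i : ℤ) * h - h = a - (i + 1) * h by ring,
      show (a : ℝ) - (i - j) * h + h = a - (i - j - 1) * h by ring,
      show (a : ℝ) - (i - j) * h - h = a - (i - j + 1) * h by ring]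
    ring
  have h3 := wH'_eq (k * h) (by positivity) a
  rw [Finset.sum_congr rfl fun i _ => Finset.sum_congr rfl fun j _ => e i j]
  have key : ∀ (X : ℕ → ℕ → ℝ) (Y : ℕ → ℝ),
      ∑ i ∈ Finset.range k, ∑ j ∈ Finset.range k, (X i j - Y i) =
        ∑ i ∈ Finset.range k, ∑ j ∈ Finset.range k, X i j - k * ∑ i ∈ Finset.range k, Y i := by
    intro X Y
    simp [Finset.sum_sub_distrib, Finset.mul_sum]
  rw [key, h1, h2, h3]
  push_cast
  simp only [zero_mul, sub_zero, sub_neg_eq_add, neg_mul]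
  field_simp
  ring

/-- The inner sum of the Selberg integral over a box `[1,R]`. -/
noncomputable def selbergSum (g : ℕ → ℝ) (R h : ℕ) (y : ℤ) : ℝ :=
  ∑ n ∈ Finset.Icc 1 R, wH' h ((n : ℤ) - y) * g n

/-- The short interval sum of `g` over `(y, y + h]`, inside a box `[1,R]`. -/
noncomputable def shortSum (g : ℕ → ℝ) (R h : ℕ) (y : ℤ) : ℝ :=
  ∑ n ∈ Finset.Icc 1 R, uH h ((n : ℤ) - y) * g n

theorem shortSum_sub_shift (g : ℕ → ℝ) (R h : ℕ) (hh : 0 < h) (y : ℤ) :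
    shortSum g R h y - shortSum g R h (y + h) =
      4 * selbergSum g R (2 * h) (y + h) + 2 * selbergSum g R (2 * h) (y + 2 * h)
      + 4 * selbergSum g R (2 * h) (y + 3 * h) - 3 * selbergSum g R (3 * h) (y + 2 * h)
      - selbergSum g R h y - 3 * selbergSum g R h (y + h) - 3 * selbergSum g R h (y + 2 * h)
      - 3 * selbergSum g R h (y + 3 * h) - selbergSum g R h (y + 4 * h) := by
  unfold shortSum selbergSum
  simp only [Finset.mul_sum, ← Finset.sum_sub_distrib, ← Finset.sum_add_distrib]
  refine Finset.sum_congr rfl fun n _ => ?_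
  have := uH_sub_shift h hh ((n : ℤ) - y)
  simp only [sub_sub] at this ⊢
  linear_combination (g n) * this

theorem mul_selbergSum_mul (g : ℕ → ℝ) (R h k : ℕ) (hh : 0 < h) (hk : 0 < k) (y : ℤ) :
    k * selbergSum g R (k * h) y = ∑ i ∈ Finset.range k, ∑ j ∈ Finset.range k,
      (selbergSum g R h (y + ((i : ℤ) - j) * h)
        + (shortSum g R h (y + ((i : ℤ) - j) * h) - shortSum g R h (y + i * h))) := by
  unfold shortSum selbergSum
  simp only [← Finset.sum_sub_distrib, ← Finset.sum_add_distrib]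
  rw [Finset.mul_sum]
  simp_rw [Finset.sum_comm (t := Finset.Icc 1 R)]
  refine Finset.sum_congr rfl fun n _ => ?_
  rw [← mul_assoc, mul_wH'_mul h k hh hk, Finset.sum_mul]
  refine Finset.sum_congr rfl fun i _ => ?_
  rw [Finset.sum_mul]
  refine Finset.sum_congr rfl fun j _ => ?_
  simp only [sub_sub]
  ring

theorem shortSum_sub_shift_mul (g : ℕ → ℝ) (R h j : ℕ) (v : ℤ) :
    shortSum g R h v - shortSum g R h (v + j * h) =
      ∑ s ∈ Finset.range j,
        (shortSum g R h (v + s * h) - shortSum g R h (v + s * h + h)) := by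
  have := Finset.sum_range_sub' (fun s : ℕ => shortSum g R h (v + s * h)) j
  simp only [Nat.cast_zero, zero_mul, add_zero] at this
  rw [← this]
  refine Finset.sum_congr rfl fun s _ => ?_
  push_cast
  rw [show v + ((s : ℤ) + 1) * h = v + s * h + h by ring]

theorem sq_shortSum_sub_shift_le (g : ℕ → ℝ) (R h : ℕ) (hh : 0 < h) (y : ℤ) :
    (shortSum g R h y - shortSum g R h (y + h)) ^ 2 ≤
      74 * (selbergSum g R (2 * h) (y + (1 : ℤ) * h) ^ 2
      + selbergSum g R (2 * h) (y + (2 : ℤ) * h) ^ 2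
      + selbergSum g R (2 * h) (y + (3 : ℤ) * h) ^ 2
      + selbergSum g R (3 * h) (y + (2 : ℤ) * h) ^ 2
      + selbergSum g R (1 * h) (y + (0 : ℤ) * h) ^ 2
      + selbergSum g R (1 * h) (y + (1 : ℤ) * h) ^ 2
      + selbergSum g R (1 * h) (y + (2 : ℤ) * h) ^ 2
      + selbergSum g R (1 * h) (y + (3 : ℤ) * h) ^ 2
      + selbergSum g R (1 * h) (y + (4 : ℤ) * h) ^ 2) := by
  rw [shortSum_sub_shift g R h hh y]
  simp only [one_mul, zero_mul, add_zero]
  generalize selbergSum g R (2 * h) (y + h) = a1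
  generalize selbergSum g R (2 * h) (y + 2 * h) = a2
  generalize selbergSum g R (2 * h) (y + 3 * h) = a3
  generalize selbergSum g R (3 * h) (y + 2 * h) = a4
  generalize selbergSum g R h y = a5
  generalize selbergSum g R h (y + h) = a6
  generalize selbergSum g R h (y + 2 * h) = a7
  generalize selbergSum g R h (y + 3 * h) = a8
  generalize selbergSum g R h (y + 4 * h) = a9
  have := Finset.sum_mul_sq_le_sq_mul_sq (Finset.univ : Finset (Fin 9))
    ![4, 2, 4, -3, -1, -3, -3, -3, -1] ![a1, a2, a3, a4, a5, a6, a7, a8, a9]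
  simp [Fin.sum_univ_succ] at this
  norm_num at this
  refine le_trans (le_of_eq ?_) (this.trans (le_of_eq ?_)) <;> ring

/-- Mean squares of Selberg sums of length `k * h` are controlled by those of lengths
`h`, `2h`, `3h`, at the cost of a power of `k`. -/
theorem sum_sq_selbergSum_mul_le (g : ℕ → ℝ) (R h k : ℕ) (hh : 0 < h) (hk : 0 < k)
    (I J : Finset ℤ) (U : ℝ)
    (hIJ : ∀ y ∈ I, ∀ l : ℤ, -(2 * k + 4 : ℤ) ≤ l → l ≤ 2 * k + 4 → y + l * h ∈ J)
    (hU : ∀ r : ℕ, 1 ≤ r → r ≤ 3 → ∑ v ∈ J, selbergSum g R (r * h) v ^ 2 ≤ U) :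
    ∑ y ∈ I, selbergSum g R (k * h) y ^ 2 ≤ 1334 * (k : ℝ) ^ 4 * U := by
  have kR : (1 : ℝ) ≤ k := by exact_mod_cast hk
  have hT : ∀ l : ℤ, -(2 * k + 4 : ℤ) ≤ l → l ≤ 2 * k + 4 → ∀ r : ℕ, 1 ≤ r → r ≤ 3 →
      ∑ y ∈ I, selbergSum g R (r * h) (y + l * h) ^ 2 ≤ U := by
    intro l hl1 hl2 r hr1 hr2
    refine le_trans ?_ (hU r hr1 hr2)
    rw [← Finset.sum_image (s := I) (g := fun y => y + l * h)
      (f := fun v => selbergSum g R (r * h) v ^ 2) (fun a _ b _ hab => by simpa using hab)]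
    refine Finset.sum_le_sum_of_subset_of_nonneg ?_ fun _ _ _ => sq_nonneg _
    intro v hv
    obtain ⟨y, hy, rfl⟩ := Finset.mem_image.1 hv
    exact hIJ y hy l hl1 hl2
  have hU0 : 0 ≤ U := le_trans (Finset.sum_nonneg fun _ _ => sq_nonneg _) (hU 1 le_rfl (by norm_num))
  have hE : ∀ l : ℤ, -(2 * k : ℤ) ≤ l → l ≤ 2 * k →
      ∑ y ∈ I, (shortSum g R h (y + l * h) - shortSum g R h (y + l * h + h)) ^ 2 ≤ 666 * U := by
    intro l hl1 hl2
    refine (Finset.sum_le_sum fun y _ => sq_shortSum_sub_shift_le g R h hh (y + l * h)).trans ?_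
    simp only [add_assoc, ← add_mul]
    rw [← Finset.mul_sum]
    simp only [Finset.sum_add_distrib]
    linarith [hT (l + 1) (by linarith) (by linarith) 2 (by norm_num) (by norm_num),
      hT (l + 2) (by linarith) (by linarith) 2 (by norm_num) (by norm_num),
      hT (l + 3) (by linarith) (by linarith) 2 (by norm_num) (by norm_num),
      hT (l + 2) (by linarith) (by linarith) 3 (by norm_num) (by norm_num),
      hT (l + 0) (by linarith) (by linarith) 1 (by norm_num) (by norm_num),
      hT (l + 1) (by linarith) (by linarith) 1 (by norm_num) (by norm_num),
      hT (l + 2) (by linarith) (by linarith) 1 (by norm_num) (by norm_num),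
      hT (l + 3) (by linarith) (by linarith) 1 (by norm_num) (by norm_num),
      hT (l + 4) (by linarith) (by linarith) 1 (by norm_num) (by norm_num)]
  set E : ℤ → ℝ := fun v => shortSum g R h v - shortSum g R h (v + h) with hEdef
  have hpt : ∀ y : ℤ, ((k : ℝ) * selbergSum g R (k * h) y) ^ 2 ≤
      (k : ℝ) * ∑ i ∈ Finset.range k, ((k : ℝ) * ∑ j ∈ Finset.range k,
        (2 * (selbergSum g R (1 * h) (y + ((i : ℤ) - j) * h) ^ 2
          + k * ∑ s ∈ Finset.range k, E (y + ((i : ℤ) - j + s) * h) ^ 2))) := by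
    intro y
    rw [mul_selbergSum_mul g R h k hh hk]
    refine sq_sum_le_card_mul_sum_sq.trans ?_
    rw [Finset.card_range]
    gcongr with i hi
    refine sq_sum_le_card_mul_sum_sq.trans ?_
    rw [Finset.card_range]
    gcongr with j hj
    refine add_sq_le.trans ?_
    rw [one_mul]
    gcongr
    rw [show y + (i : ℤ) * h = y + ((i : ℤ) - j) * h + j * h by ring, shortSum_sub_shift_mul]
    refine sq_sum_le_card_mul_sum_sq.trans ?_
    have hjk : j ≤ k := (Finset.mem_range.1 hj).le
    rw [Finset.card_range]
    gcongr
    refine le_trans (le_of_eq ?_) (Finset.sum_le_sum_of_subset_of_nonneg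
      (Finset.range_subset_range.2 hjk) fun _ _ _ => sq_nonneg _)
    refine Finset.sum_congr rfl fun s _ => ?_
    rw [hEdef]
    simp only
    rw [show y + ((i : ℤ) - j) * h + s * h = y + ((i : ℤ) - j + s) * h by ring]
  have hsum : ∑ y ∈ I, ((k : ℝ) * selbergSum g R (k * h) y) ^ 2 ≤
      (k : ℝ) * ∑ _i ∈ Finset.range k, ((k : ℝ) * ∑ _j ∈ Finset.range k,
        (2 * (U + k * ∑ _s ∈ Finset.range k, 666 * U))) := by
    refine (Finset.sum_le_sum fun y _ => hpt y).trans ?_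
    rw [← Finset.mul_sum, Finset.sum_comm]
    gcongr with i hi
    rw [← Finset.mul_sum, Finset.sum_comm]
    gcongr with j hj
    have hi' := Finset.mem_range.1 hi
    have hj' := Finset.mem_range.1 hj
    rw [← Finset.mul_sum, Finset.sum_add_distrib, ← Finset.mul_sum, Finset.sum_comm]
    gcongr with s hs
    · exact hT _ (by linarith) (by linarith) 1 le_rfl (by norm_num)
    · have hs' := Finset.mem_range.1 hs
      exact hE _ (by linarith) (by linarith)
  simp only [Finset.sum_const, Finset.card_range, nsmul_eq_mul, mul_pow, ← Finset.mul_sum] at hsum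
  have h1 : (k : ℝ) ^ 2 * ∑ y ∈ I, selbergSum g R (k * h) y ^ 2
      ≤ (k : ℝ) ^ 2 * (1334 * (k : ℝ) ^ 4 * U) := by
    refine hsum.trans ?_
    have : (1 : ℝ) ≤ (k : ℝ) ^ 2 := one_le_pow₀ kR
    have h2 : U * k ^ 4 ≤ U * k ^ 4 * k ^ 2 := le_mul_of_one_le_right (by positivity) this
    nlinarith [h2]
  exact le_of_mul_le_mul_left h1 (by positivity)

theorem card_filter_abs_sub_le (S : Finset ℕ) (c t : ℝ) (ht : 0 ≤ t) :
    ((S.filter fun n : ℕ => |(n : ℝ) - c| ≤ t).card : ℝ) ≤ 2 * t + 1 := by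
  have h1 : (S.filter fun n : ℕ => |(n : ℝ) - c| ≤ t).card ≤ (Finset.Icc ⌈c - t⌉ ⌊c + t⌋).card := by
    refine Finset.card_le_card_of_injOn (fun n => (n : ℤ)) ?_ fun a _ b _ hab => by simpa using hab
    intro n hn
    have hn' := abs_le.1 (Finset.mem_filter.1 hn).2
    simp only [Finset.coe_Icc, Set.mem_Icc]
    constructor
    · exact Int.ceil_le.2 (by push_cast; linarith [hn'.1])
    · exact Int.le_floor.2 (by push_cast; linarith [hn'.2])
  rw [Int.card_Icc] at h1
  have h2 : ((⌊c + t⌋ + 1 - ⌈c - t⌉).toNat : ℝ) ≤ 2 * t + 1 := by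
    rcases le_total 0 (⌊c + t⌋ + 1 - ⌈c - t⌉) with h | h
    · have : ((⌊c + t⌋ + 1 - ⌈c - t⌉).toNat : ℝ) = ((⌊c + t⌋ + 1 - ⌈c - t⌉ : ℤ) : ℝ) := by
        exact_mod_cast congrArg (Int.cast (R := ℝ)) (Int.toNat_of_nonneg h)
      rw [this]
      push_cast
      linarith [Int.floor_le (c + t), Int.le_ceil (c - t)]
    · rw [Int.toNat_of_nonpos h]
      push_cast
      linarith
  exact (by exact_mod_cast h1 : _ ≤ _).trans h2

/-- The weight `w'` with a real length and a real argument. -/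
noncomputable def triStep (κ a : ℝ) : ℝ :=
  max (1 - |a| / κ) 0 - if 0 < a ∧ a ≤ κ then 1 else 0

theorem wH'_eq_triStep (h : ℕ) (a : ℤ) : wH' h a = triStep h a := by
  unfold wH' cesaroH uH triStep
  norm_cast

theorem triStep_div (κ a m : ℝ) (hm : 0 < m) : triStep (κ / m) (a / m) = triStep κ a := by
  unfold triStep
  rw [abs_div, abs_of_pos hm, div_div_div_cancel_right₀ hm.ne']
  simp only [div_le_div_iff_of_pos_right hm, div_pos_iff_of_pos_right hm]

theorem abs_triStep_le (κ a : ℝ) (hκ : 0 < κ) : |triStep κ a| ≤ 1 := by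
  unfold triStep
  have h1 : max (1 - |a| / κ) 0 ≤ 1 := max_le (by linarith [div_nonneg (abs_nonneg a) hκ.le]) zero_le_one
  have h2 : 0 ≤ max (1 - |a| / κ) 0 := le_max_right _ _
  rw [abs_le]
  split_ifs <;> constructor <;> linarith

theorem triStep_eq_zero (κ a : ℝ) (hκ : 0 < κ) (h : κ < |a|) : triStep κ a = 0 := by
  unfold triStep
  rw [max_eq_right, if_neg, sub_zero]
  · rintro ⟨h1, h2⟩
    rw [abs_of_pos h1] at h
    linarith
  · rw [sub_nonpos, le_div_iff₀ hκ]
    linarith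

theorem abs_max_sub_max_le (κ L a b E : ℝ) (hκ : 0 < κ) (hL : 0 < L)
    (h1 : |κ - L| ≤ E) (h2 : |a - b| ≤ E) :
    |max (1 - |a| / κ) 0 - max (1 - |b| / L) 0| ≤ 2 * E / L := by
  have hE : 0 ≤ E := (abs_nonneg _).trans h1
  have hab := abs_le.1 ((abs_abs_sub_abs_le a b).trans h2)
  have hκL := abs_le.1 h1
  have ha := abs_nonneg a
  have hb := abs_nonneg b
  have e1 : ∀ s : ℝ, |a| / κ ≤ 1 → |b| / L = |a| / κ + (|b| - |a|) / L + (|a| / κ) * (κ - L) / L := by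
    intro _ _
    field_simp
    ring
  rcases le_total (|a| / κ) 1 with h | h
  · have e2 := e1 0 h
    have h0 : 0 ≤ |a| / κ := by positivity
    have h3 : |(|b| - |a|) / L + (|a| / κ) * (κ - L) / L| ≤ 2 * E / L := by
      rw [← add_div, abs_div, abs_of_pos hL]
      gcongr
      refine (abs_add_le _ _).trans ?_
      have : |(|a| / κ) * (κ - L)| ≤ 1 * E := by
        rw [abs_mul, abs_of_nonneg h0]
        gcongr
      have : |(|b| - |a|)| ≤ E := by rw [abs_le]; constructor <;> linarith
      linarith
    refine (abs_max_sub_max_le_abs _ _ _).trans ?_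
    rw [show 1 - |a| / κ - (1 - |b| / L) = |b| / L - |a| / κ by ring, e2]
    refine le_trans (le_of_eq ?_) h3
    congr 1
    ring
  · rw [max_eq_right (by linarith : 1 - |a| / κ ≤ 0), zero_sub, abs_neg,
      abs_of_nonneg (le_max_right _ _)]
    refine max_le ?_ (by positivity)
    have : κ ≤ |a| := by rwa [le_div_iff₀ hκ, one_mul] at h
    rw [sub_le_iff_le_add, ← add_div, le_div_iff₀ hL]
    linarith

theorem abs_triStep_sub_le (κ L a b E : ℝ) (hκ : 0 < κ) (hL : 0 < L)
    (h1 : |κ - L| ≤ E) (h2 : |a - b| ≤ E) :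
    |triStep κ a - triStep L b| ≤
      (if |b| ≤ L + 2 * E then 2 * E / L else 0) + (if |b| ≤ E then 1 else 0)
        + (if |b - L| ≤ 2 * E then 1 else 0) := by
  have hE : 0 ≤ E := (abs_nonneg _).trans h1
  have hab := abs_le.1 h2
  have hab' := abs_le.1 ((abs_abs_sub_abs_le a b).trans h2)
  have hκL := abs_le.1 h1
  have c1 : |max (1 - |a| / κ) 0 - max (1 - |b| / L) 0| ≤
      (if |b| ≤ L + 2 * E then 2 * E / L else 0) := by
    split_ifs with h
    · exact abs_max_sub_max_le κ L a b E hκ hL h1 h2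
    · push Not at h
      rw [max_eq_right, max_eq_right]
      · simp
      · rw [sub_nonpos, le_div_iff₀ hL]; linarith
      · rw [sub_nonpos, le_div_iff₀ hκ]; linarith
  have c2 : |(if 0 < a ∧ a ≤ κ then (1 : ℝ) else 0) - (if 0 < b ∧ b ≤ L then (1 : ℝ) else 0)| ≤
      (if |b| ≤ E then 1 else 0) + (if |b - L| ≤ 2 * E then 1 else 0) := by
    by_cases hb1 : |b| ≤ E
    · rw [if_pos hb1]
      have : (0 : ℝ) ≤ if |b - L| ≤ 2 * E then 1 else 0 := by split_ifs <;> norm_num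
      refine le_trans ?_ (le_add_of_nonneg_right this)
      split_ifs <;> norm_num
    · by_cases hb2 : |b - L| ≤ 2 * E
      · rw [if_pos hb2, if_neg hb1]
        split_ifs <;> norm_num
      · rw [if_neg hb1, if_neg hb2]
        push Not at hb1 hb2
        have : (0 < a ∧ a ≤ κ) ↔ (0 < b ∧ b ≤ L) := by
          rcases lt_abs.1 hb1 with q1 | q1 <;> rcases lt_abs.1 hb2 with q2 | q2 <;>
            constructor <;> rintro ⟨r1, r2⟩ <;> constructor <;> linarith
        simp only [this]
        simp
  unfold triStep
  rw [show ∀ p q r s : ℝ, p - q - (r - s) = (p - r) - (q - s) by intros; ring, add_assoc]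
  exact (abs_sub _ _).trans (add_le_add c1 c2)

/-- Replacing the parameters of the weight by nearby integers changes a weighted sum only by a
quantity proportional to the perturbation. -/
theorem abs_sum_triStep_sub_selbergSum_le (g : ℕ → ℝ) (R L : ℕ) (y : ℤ) (κ z E B : ℝ)
    (hκ : 0 < κ) (hL : 0 < L) (hE1 : 1 ≤ E) (hEL : E ≤ L) (h1 : |κ - L| ≤ E) (h2 : |z - y| ≤ E)
    (hB : ∀ n ∈ Finset.Icc 1 R, |g n| ≤ B) (hB0 : 0 ≤ B) :
    |∑ n ∈ Finset.Icc 1 R, triStep κ (n - z) * g n - selbergSum g R L y| ≤ 22 * E * B := by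
  have hL' : (0 : ℝ) < L := by exact_mod_cast hL
  unfold selbergSum
  rw [← Finset.sum_sub_distrib]
  have hpt : ∀ n ∈ Finset.Icc 1 R,
      |triStep κ (n - z) * g n - wH' L ((n : ℤ) - y) * g n| ≤
      ((if |(n : ℝ) - y| ≤ L + 2 * E then 2 * E / L else 0)
        + (if |(n : ℝ) - y| ≤ E then 1 else 0)
        + (if |(n : ℝ) - (y + L)| ≤ 2 * E then 1 else 0)) * B := by
    intro n hn
    rw [← sub_mul, abs_mul, wH'_eq_triStep]
    have h3 := abs_triStep_sub_le κ L (n - z) (n - y) E hκ hL' h1 (by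
      rw [show (n : ℝ) - z - (n - y) = -(z - y) by ring, abs_neg]; exact h2)
    rw [sub_sub] at h3
    push_cast
    have := hB n hn
    exact mul_le_mul h3 this (abs_nonneg _) ((abs_nonneg _).trans h3)
  refine (Finset.abs_sum_le_sum_abs _ _).trans ((Finset.sum_le_sum hpt).trans ?_)
  rw [← Finset.sum_mul, Finset.sum_add_distrib, Finset.sum_add_distrib]
  gcongr
  rw [← Finset.sum_filter, ← Finset.sum_filter, ← Finset.sum_filter]
  simp only [Finset.sum_const, nsmul_eq_mul, mul_one]
  have k1 := card_filter_abs_sub_le (Finset.Icc 1 R) y (L + 2 * E) (by positivity)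
  have k2 := card_filter_abs_sub_le (Finset.Icc 1 R) y E (by positivity)
  have k3 := card_filter_abs_sub_le (Finset.Icc 1 R) (y + L) (2 * E) (by positivity)
  have k4 := mul_le_mul_of_nonneg_right k1 (by positivity : 0 ≤ 2 * E / L)
  have k5 : (2 * (L + 2 * E) + 1) * (2 * E / L) ≤ 14 * E := by
    rw [mul_div_assoc', div_le_iff₀ hL']
    nlinarith
  linarith

theorem sum_comp_div_le (φ : ℤ → ℝ) (hφ : ∀ y, 0 ≤ φ y) (N m : ℕ) (hm : 0 < m) :
    ∑ x ∈ Finset.Ioc N (2 * N), φ ((x / m : ℕ) : ℤ) ≤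
      m * ∑ y ∈ Finset.Icc ((N / m : ℕ) : ℤ) ((2 * N / m : ℕ) : ℤ), φ y := by
  have hmap : ∀ x ∈ Finset.Ioc N (2 * N), ((x / m : ℕ) : ℤ) ∈
      Finset.Icc ((N / m : ℕ) : ℤ) ((2 * N / m : ℕ) : ℤ) := by
    intro x hx
    rw [Finset.mem_Ioc] at hx
    rw [Finset.mem_Icc]
    exact ⟨by exact_mod_cast Nat.div_le_div_right hx.1.le, by exact_mod_cast Nat.div_le_div_right hx.2⟩
  rw [← Finset.sum_fiberwise_of_maps_to hmap, Finset.mul_sum]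
  refine Finset.sum_le_sum fun y hy => ?_
  rw [Finset.sum_congr rfl (g := fun _ => φ y) fun x hx => by rw [(Finset.mem_filter.1 hx).2],
    Finset.sum_const, nsmul_eq_mul]
  refine mul_le_mul_of_nonneg_right ?_ (hφ y)
  have : (Finset.filter (fun x => ((x / m : ℕ) : ℤ) = y) (Finset.Ioc N (2 * N))).card ≤
      (Finset.Ico (m * y.toNat) (m * y.toNat + m)).card := by
    refine Finset.card_le_card fun x hx => ?_
    have := (Finset.mem_filter.1 hx).2
    rw [Finset.mem_Ico, ← this, Int.toNat_natCast]
    exact ⟨Nat.mul_div_le x m, by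
      have := Nat.div_add_mod x m
      have := Nat.mod_lt x hm
      omega⟩
  simp only [Nat.card_Ico, add_tsub_cancel_left] at this
  exact_mod_cast this

theorem Jw'_eq_sum_selbergSum (g : ℕ → ℝ) (M h R : ℕ) (hh : 0 < h) (hR : 2 * M + h ≤ R) :
    Jw' g M h = ∑ v ∈ Finset.Ioc (M : ℤ) ((2 * M : ℕ) : ℤ), selbergSum g R h v ^ 2 := by
  have : Finset.Ioc (M : ℤ) ((2 * M : ℕ) : ℤ) =
      (Finset.Ioc M (2 * M)).map Nat.castEmbedding := by
    ext v
    simp only [Finset.mem_Ioc, Finset.mem_map, Nat.castEmbedding_apply]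
    constructor
    · intro hv
      exact ⟨v.toNat, by omega, by omega⟩
    · rintro ⟨x, hx, rfl⟩
      omega
  rw [this, Finset.sum_map, Jw']
  refine Finset.sum_congr rfl fun x hx => ?_
  rw [Finset.mem_Ioc] at hx
  unfold selbergSum
  congr 1
  refine Finset.sum_subset (Finset.Icc_subset_Icc_right (by omega)) fun n hn hn' => ?_
  rw [Finset.mem_Icc] at hn hn'
  rw [wH'_eq_triStep, triStep_eq_zero, zero_mul]
  · exact_mod_cast hh
  · rw [lt_abs]
    left
    push_cast
    have : (x : ℝ) + h < n := by exact_mod_cast (by omega : x + h < n)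
    linarith

theorem exists_mul_approx (κ W lo Q : ℝ) (hW : 1 ≤ lo * W)
    (h1 : lo * W ≤ κ) (h2 : κ ≤ Q * (lo * W)) :
    ∃ k h : ℕ, 0 < k ∧ 0 < h ∧ (k : ℝ) ≤ Q ∧ (k : ℝ) * h ≤ κ ∧ κ - k ≤ (k : ℝ) * h ∧
      lo / 2 * W ≤ h ∧ (h : ℝ) ≤ 2 * lo * W := by
  set V := lo * W with hV
  have hV0 : 0 < V := by linarith
  have hκ : 0 < κ := by linarith
  have q1 : 1 ≤ κ / V := by rwa [one_le_div hV0]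
  have k1 : 1 ≤ ⌊κ / V⌋₊ := Nat.one_le_floor_iff _ |>.2 q1
  set k := ⌊κ / V⌋₊ with hk
  have kR : (1 : ℝ) ≤ k := by exact_mod_cast k1
  have k2 : (k : ℝ) ≤ κ / V := Nat.floor_le (by positivity)
  have k3 : κ / V < k + 1 := Nat.lt_floor_add_one _
  have k4 : (k : ℝ) * V ≤ κ := by rwa [le_div_iff₀ hV0] at k2
  have k5 : κ < (k + 1) * V := by rwa [div_lt_iff₀ hV0] at k3
  have t1 : V ≤ κ / k := by rw [le_div_iff₀ (by linarith)]; linarith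
  have t2 : κ / k ≤ 2 * V := by rw [div_le_iff₀ (by linarith)]; nlinarith
  have h3 : 1 ≤ ⌊κ / k⌋₊ := Nat.one_le_floor_iff _ |>.2 (by linarith)
  set h := ⌊κ / k⌋₊ with hh
  have hR : (1 : ℝ) ≤ h := by exact_mod_cast h3
  have h4 : (h : ℝ) ≤ κ / k := Nat.floor_le (by positivity)
  have h5 : κ / k < h + 1 := Nat.lt_floor_add_one _
  have h6 : (h : ℝ) * k ≤ κ := by rwa [le_div_iff₀ (by linarith)] at h4
  have h7 : κ < (h + 1) * k := by rwa [div_lt_iff₀ (by linarith)] at h5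
  refine ⟨k, h, k1, h3, ?_, by linarith, by linarith, ?_, ?_⟩
  · exact k2.trans (by rw [div_le_iff₀ hV0]; exact h2)
  · rw [show lo / 2 * W = V / 2 by rw [hV]; ring]
    linarith
  · rw [mul_assoc]
    linarith

theorem sum_Ioc_sixteen_le (g : ℕ → ℝ) (G θ lo C₀ : ℝ) (hG1 : 0 < G) (hG2 : G < 1)
    (hθ1 : 0 < θ) (hθ2 : θ < 1) (hlo : 0 < lo) (hC₀ : 0 < C₀)
    (hyp : ∀ M h : ℕ, 0 < M → 0 < h →
      lo / 4 * (M : ℝ) ^ θ ≤ (h : ℝ) → (h : ℝ) ≤ 48 * lo * (M : ℝ) ^ θ →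
      Jw' g M h ≤ C₀ * (M : ℝ) * (h : ℝ) ^ (2 - G))
    (Z κ : ℝ) (hZ : 16 ≤ Z) (R h r : ℕ) (hr1 : 1 ≤ r) (hr3 : r ≤ 3) (hh : 0 < h)
    (hhκ : (h : ℝ) ≤ κ) (h1 : lo / 2 * Z ^ θ ≤ h) (h2 : (h : ℝ) ≤ 2 * lo * Z ^ θ)
    (hR : 4 * Z + 3 * h ≤ R) :
    ∑ v ∈ Finset.Ioc (⌊Z / 4⌋₊ : ℤ) (16 * ⌊Z / 4⌋₊), selbergSum g R (r * h) v ^ 2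
      ≤ 72 * C₀ * Z * κ ^ (2 - G) := by
  set M₀ := ⌊Z / 4⌋₊ with hM
  have hM1 : (M₀ : ℝ) ≤ Z / 4 := Nat.floor_le (by positivity)
  have hM2 : Z / 4 < M₀ + 1 := Nat.lt_floor_add_one _
  have hhR : (0 : ℝ) < h := by exact_mod_cast hh
  have hκ : 0 < κ := by linarith
  have hM0 : 0 < M₀ := by
    have : (0 : ℝ) < M₀ := by linarith
    exact_mod_cast this
  have hrR1 : (1 : ℝ) ≤ r := by exact_mod_cast hr1
  have hrR3 : (r : ℝ) ≤ 3 := by exact_mod_cast hr3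
  have hJ : ∀ M : ℕ, 0 < M → Z / 8 ≤ M → (M : ℝ) ≤ 2 * Z →
      ∑ v ∈ Finset.Ioc (M : ℤ) ((2 * M : ℕ) : ℤ), selbergSum g R (r * h) v ^ 2
        ≤ 18 * C₀ * Z * κ ^ (2 - G) := by
    intro M hM0 hMl hMu
    have hrh : (r : ℝ) * h ≤ 3 * h := by gcongr
    have hMR : (0 : ℝ) < M := by exact_mod_cast hM0
    rw [← Jw'_eq_sum_selbergSum g M (r * h) R (by positivity) (by
      have : (2 * M + (r * h : ℕ) : ℝ) ≤ R := by push_cast; linarith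
      exact_mod_cast this)]
    refine (hyp M (r * h) hM0 (by positivity) ?_ ?_).trans ?_
    · push_cast
      have : (M : ℝ) ^ θ ≤ 2 * Z ^ θ := by
        calc (M : ℝ) ^ θ ≤ (2 * Z) ^ θ := by gcongr
          _ = 2 ^ θ * Z ^ θ := Real.mul_rpow (by norm_num) (by linarith)
          _ ≤ 2 ^ (1 : ℝ) * Z ^ θ := by
            gcongr
            norm_num
          _ = 2 * Z ^ θ := by rw [Real.rpow_one]
      nlinarith
    · push_cast
      have : Z ^ θ ≤ 8 * (M : ℝ) ^ θ := by
        calc Z ^ θ ≤ (8 * M : ℝ) ^ θ := by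
              gcongr
              linarith
          _ = 8 ^ θ * (M : ℝ) ^ θ := Real.mul_rpow (by norm_num) (by linarith)
          _ ≤ 8 ^ (1 : ℝ) * (M : ℝ) ^ θ := by
            gcongr
            norm_num
          _ = 8 * (M : ℝ) ^ θ := by rw [Real.rpow_one]
      have h3 : 2 * lo * Z ^ θ ≤ 2 * lo * (8 * (M : ℝ) ^ θ) := by gcongr
      linarith
    · push_cast
      have : ((r : ℝ) * h) ^ (2 - G) ≤ 9 * κ ^ (2 - G) := by
        calc ((r : ℝ) * h) ^ (2 - G) ≤ (3 * κ) ^ (2 - G) := by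
              gcongr
              linarith
          _ = 3 ^ (2 - G) * κ ^ (2 - G) := Real.mul_rpow (by norm_num) hκ.le
          _ ≤ 3 ^ (2 : ℝ) * κ ^ (2 - G) := by
              gcongr
              · norm_num
              · linarith
          _ = 9 * κ ^ (2 - G) := by norm_num
      calc C₀ * (M : ℝ) * ((r : ℝ) * h) ^ (2 - G) ≤ C₀ * (2 * Z) * (9 * κ ^ (2 - G)) := by gcongr
        _ = _ := by ring
  have hadd : ∀ a b c : ℤ, a ≤ b → b ≤ c → ∀ F : ℤ → ℝ,
      ∑ v ∈ Finset.Ioc a c, F v = ∑ v ∈ Finset.Ioc a b, F v + ∑ v ∈ Finset.Ioc b c, F v := by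
    intro a b c hab hbc F
    rw [← Finset.Ioc_union_Ioc_eq_Ioc hab hbc, Finset.sum_union]
    exact Finset.Ioc_disjoint_Ioc_of_le le_rfl
  rw [hadd _ (2 * M₀) _ (by omega) (by omega), hadd (2 * M₀) (4 * M₀) _ (by omega) (by omega),
    hadd (4 * M₀) (8 * M₀) _ (by omega) (by omega)]
  have j1 := hJ M₀ hM0 (by linarith) (by linarith)
  have j2 := hJ (2 * M₀) (by omega) (by push_cast; linarith) (by push_cast; linarith)
  have j3 := hJ (4 * M₀) (by omega) (by push_cast; linarith) (by push_cast; linarith)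
  have j4 := hJ (8 * M₀) (by omega) (by push_cast; linarith) (by push_cast; linarith)
  push_cast at j1 j2 j3 j4
  simp only [← mul_assoc] at j1 j2 j3 j4
  norm_num at j1 j2 j3 j4
  linarith

theorem exists_scale_threshold (θ η lo hi : ℝ) (hθ : 0 < θ) (hθη : θ + η < 1)
    (hlo : 0 < lo) :
    ∃ Z₀ : ℝ, 16 ≤ Z₀ ∧ ∀ Z : ℝ, Z₀ ≤ Z → 1 ≤ lo * Z ^ θ ∧ hi * Z ^ (θ + η) ≤ Z / 12 := by
  have e1 : ∀ᶠ Z : ℝ in Filter.atTop, 1 / lo ≤ Z ^ θ :=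
    (tendsto_rpow_atTop hθ).eventually_ge_atTop _
  have e2 : ∀ᶠ Z : ℝ in Filter.atTop, 12 * hi ≤ Z ^ (1 - (θ + η)) :=
    (tendsto_rpow_atTop (by linarith)).eventually_ge_atTop _
  obtain ⟨Z₀, hZ₀⟩ := Filter.eventually_atTop.1 (e1.and e2)
  refine ⟨max Z₀ 16, le_max_right _ _, fun Z hZ => ?_⟩
  have hZ16 : 16 ≤ Z := (le_max_right _ _).trans hZ
  obtain ⟨h1, h2⟩ := hZ₀ Z ((le_max_left _ _).trans hZ)
  refine ⟨by rwa [div_le_iff₀' hlo] at h1, ?_⟩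
  have : Z ^ (1 - (θ + η)) * Z ^ (θ + η) = Z := by
    rw [← Real.rpow_add (by linarith)]
    simp
  have h3 : 12 * hi * Z ^ (θ + η) ≤ Z ^ (1 - (θ + η)) * Z ^ (θ + η) := by gcongr
  linarith

/-- The inner sums of the Selberg integral of `g` along multiples of `m`. -/
noncomputable def dilatedSum (g : ℕ → ℝ) (R H m x : ℕ) : ℝ :=
  ∑ d ∈ Finset.Icc 1 R, wH' H (((d * m : ℕ) : ℤ) - x) * g d

theorem dilatedSum_eq (g : ℕ → ℝ) (R H m x : ℕ) (hm : 0 < m) :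
    dilatedSum g R H m x =
      ∑ d ∈ Finset.Icc 1 R, triStep ((H : ℝ) / m) ((d : ℝ) - (x : ℝ) / m) * g d := by
  have hmR : (0 : ℝ) < m := by exact_mod_cast hm
  refine Finset.sum_congr rfl fun d _ => ?_
  rw [wH'_eq_triStep, ← triStep_div _ _ _ hmR]
  congr 2
  push_cast
  field_simp

set_option maxHeartbeats 1000000 in
theorem sum_sq_dilatedSum_le (g : ℕ → ℝ) (hg : EssBdd g) (G θ η lo hi : ℝ)
    (hG1 : 0 < G) (hG2 : G < 1) (hθ : 0 < θ) (hη : 0 < η) (hη1 : η ≤ 1) (hθη : θ + η < 1)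
    (hlo : 0 < lo) (hhi : 0 < hi)
    (hyp : ∀ c₁ c₂ : ℝ, 0 < c₁ → c₁ < c₂ →
      ∃ C : ℝ, 0 < C ∧ ∀ M h : ℕ, 0 < M → 0 < h →
        c₁ * (M : ℝ) ^ θ ≤ (h : ℝ) → (h : ℝ) ≤ c₂ * (M : ℝ) ^ θ →
        Jw' g M h ≤ C * (M : ℝ) * (h : ℝ) ^ (2 - G)) :
    ∃ C Z₀ : ℝ, 0 < C ∧ 0 < Z₀ ∧ ∀ N H m : ℕ, 0 < N → 0 < m → Z₀ ≤ (N : ℝ) / m →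
      lo * ((N : ℝ) / m) ^ θ ≤ (H : ℝ) / m → (H : ℝ) / m ≤ hi * ((N : ℝ) / m) ^ (θ + η) →
      ∑ x ∈ Finset.Ioc N (2 * N), dilatedSum g (6 * N) H m x ^ 2
        ≤ C * N * ((H : ℝ) / m) ^ (2 - G) * (N : ℝ) ^ (4 * η) := by
  obtain ⟨C₀, hC₀, hyp₀⟩ := hyp (lo / 4) (48 * lo) (by positivity) (by linarith)
  obtain ⟨Cg, hCg, hgb⟩ := hg η hη
  obtain ⟨Z₀, hZ₀16, hZ₀⟩ := exists_scale_threshold θ η lo hi hθ hθη hlo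
  set q := hi / lo with hq
  have hq0 : 0 < q := by positivity
  refine ⟨2 * 1334 * q ^ 4 * 72 * C₀ + 2 * (22 * q * (6 * Cg)) ^ 2, Z₀, by positivity,
    by linarith, fun N H m hN hm hZ hl hu => ?_⟩
  set Z := (N : ℝ) / m with hZdef
  set κ := (H : ℝ) / m with hκdef
  have hmR : (1 : ℝ) ≤ m := by exact_mod_cast hm
  have hNR : (1 : ℝ) ≤ N := by exact_mod_cast hN
  have hmZ : (m : ℝ) * Z = N := by rw [hZdef]; field_simp
  have hZ16 : 16 ≤ Z := hZ₀16.trans hZ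
  have hZN : Z ≤ N := by rw [hZdef]; exact div_le_self (by linarith) hmR
  obtain ⟨hW1, hW2⟩ := hZ₀ Z hZ
  have hκ1 : 1 ≤ κ := hW1.trans hl
  have hκZ : κ ≤ Z / 12 := hu.trans hW2
  obtain ⟨k, h, hk, hh, hkQ, hkh1, hkh2, hhl, hhu⟩ :=
    exists_mul_approx κ (Z ^ θ) lo (q * Z ^ η) hW1 hl (by
      refine hu.trans (le_of_eq ?_)
      rw [Real.rpow_add (by linarith), hq]
      field_simp)
  have hkR : (1 : ℝ) ≤ k := by exact_mod_cast hk
  have hhR : (1 : ℝ) ≤ h := by exact_mod_cast hh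
  have hhκ : (h : ℝ) ≤ κ := by nlinarith
  set P := (N : ℝ) ^ η with hP
  have hP1 : 1 ≤ P := Real.one_le_rpow hNR hη.le
  have hP4 : (N : ℝ) ^ (4 * η) = P ^ 4 := by
    rw [hP, mul_comm, Real.rpow_mul (by linarith)]
    norm_cast
  have hkP : (k : ℝ) ≤ q * P := hkQ.trans (by
    rw [hP]
    gcongr)
  set B := 6 * Cg * P with hB
  have hgB : ∀ n ∈ Finset.Icc 1 (6 * N), |g n| ≤ B := by
    intro n hn
    rw [Finset.mem_Icc] at hn
    refine (hgb n hn.1).trans ?_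
    have h1 : (n : ℝ) ^ η ≤ 6 * P := by
      calc (n : ℝ) ^ η ≤ (6 * N : ℝ) ^ η := by
            gcongr
            exact_mod_cast hn.2
        _ = 6 ^ η * P := Real.mul_rpow (by norm_num) (by linarith)
        _ ≤ 6 ^ (1 : ℝ) * P := by
            gcongr
            norm_num
        _ = 6 * P := by rw [Real.rpow_one]
    calc Cg * (n : ℝ) ^ η ≤ Cg * (6 * P) := by gcongr
      _ = B := by rw [hB]; ring
  have hpt : ∀ x ∈ Finset.Ioc N (2 * N), dilatedSum g (6 * N) H m x ^ 2 ≤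
      2 * selbergSum g (6 * N) (k * h) ((x / m : ℕ) : ℤ) ^ 2 + 2 * (22 * k * B) ^ 2 := by
    intro x _
    have hx1 : (((x / m : ℕ) : ℤ) : ℝ) ≤ (x : ℝ) / m := by
      rw [Int.cast_natCast]
      exact Nat.cast_div_le
    have hx2 : (x : ℝ) / m < (((x / m : ℕ) : ℤ) : ℝ) + 1 := by
      rw [div_lt_iff₀ (by linarith)]
      have := Nat.lt_div_mul_add (a := x) hm
      have h3 : x < (x / m + 1) * m := by linarith
      exact_mod_cast h3
    have := abs_sum_triStep_sub_selbergSum_le g (6 * N) (k * h) ((x / m : ℕ) : ℤ) κ ((x : ℝ) / m)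
      k B (by linarith) (by positivity) hkR (by push_cast; nlinarith)
      (by push_cast; rw [abs_le]; constructor <;> linarith)
      (by rw [abs_le]; constructor <;> linarith) hgB (by positivity)
    rw [← dilatedSum_eq g (6 * N) H m x hm] at this
    set s := dilatedSum g (6 * N) H m x
    set t := selbergSum g (6 * N) (k * h) ((x / m : ℕ) : ℤ)
    have h4 : (s - t) ^ 2 ≤ (22 * k * B) ^ 2 := sq_le_sq' (abs_le.1 this).1 (abs_le.1 this).2
    nlinarith [sq_nonneg (s - 2 * t)]
  have hI := sum_sq_selbergSum_mul_le g (6 * N) h k hh hk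
    (Finset.Icc ((N / m : ℕ) : ℤ) ((2 * N / m : ℕ) : ℤ))
    (Finset.Ioc (⌊Z / 4⌋₊ : ℤ) (16 * ⌊Z / 4⌋₊)) (72 * C₀ * Z * κ ^ (2 - G)) (by
      intro y hy l hl1 hl2
      rw [Finset.mem_Icc] at hy
      have hM1 : (⌊Z / 4⌋₊ : ℝ) ≤ Z / 4 := Nat.floor_le (by linarith)
      have hM2 : Z / 4 < ⌊Z / 4⌋₊ + 1 := Nat.lt_floor_add_one _
      have hy1 : Z - 1 ≤ (y : ℝ) := by
        have h1 : Z < ((N / m : ℕ) : ℝ) + 1 := by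
          rw [hZdef, div_lt_iff₀ (by linarith)]
          have := Nat.lt_div_mul_add (a := N) hm
          have h3 : N < (N / m + 1) * m := by linarith
          exact_mod_cast h3
        have h2 : (((N / m : ℕ) : ℤ) : ℝ) ≤ y := by exact_mod_cast hy.1
        rw [Int.cast_natCast] at h2
        linarith
      have hy2 : (y : ℝ) ≤ 2 * Z := by
        have h1 : ((2 * N / m : ℕ) : ℝ) ≤ ((2 * N : ℕ) : ℝ) / m := Nat.cast_div_le
        have h2 : (y : ℝ) ≤ (((2 * N / m : ℕ) : ℤ) : ℝ) := by exact_mod_cast hy.2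
        rw [Int.cast_natCast] at h2
        push_cast at h1
        rw [hZdef, mul_div_assoc']
        linarith
      have hl1' : -(2 * k + 4 : ℝ) ≤ l := by exact_mod_cast hl1
      have hl2' : (l : ℝ) ≤ 2 * k + 4 := by exact_mod_cast hl2
      have s1 : (l : ℝ) * h ≤ 6 * κ := by nlinarith
      have s2 : -(6 * κ) ≤ (l : ℝ) * h := by nlinarith
      rw [Finset.mem_Ioc]
      constructor
      · have : (⌊Z / 4⌋₊ : ℝ) < y + l * h := by linarith
        exact_mod_cast this
      · have : (y + l * h : ℝ) ≤ 16 * ⌊Z / 4⌋₊ := by linarith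
        exact_mod_cast this) (by
      intro r hr1 hr3
      refine sum_Ioc_sixteen_le g G θ lo C₀ hG1 hG2 hθ (by linarith) hlo hC₀ hyp₀ Z κ hZ16 _ h r
        hr1 hr3 hh hhκ hhl hhu ?_
      push_cast
      linarith)
  have hF := sum_comp_div_le (fun y => selbergSum g (6 * N) (k * h) y ^ 2)
    (fun _ => sq_nonneg _) N m hm
  have hκG : 1 ≤ κ ^ (2 - G) := Real.one_le_rpow hκ1 (by linarith)
  have hsum := Finset.sum_le_sum hpt
  rw [hP4]
  clear_value Z κ P B q
  clear hpt hgB hyp hyp₀ hgb hZ₀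
  generalize κ ^ (2 - G) = K at hI hκG ⊢
  have hB0 : 0 ≤ B := by rw [hB]; positivity
  calc ∑ x ∈ Finset.Ioc N (2 * N), dilatedSum g (6 * N) H m x ^ 2
      ≤ ∑ x ∈ Finset.Ioc N (2 * N),
        (2 * selbergSum g (6 * N) (k * h) ((x / m : ℕ) : ℤ) ^ 2 + 2 * (22 * k * B) ^ 2) :=
        hsum
    _ = 2 * ∑ x ∈ Finset.Ioc N (2 * N), selbergSum g (6 * N) (k * h) ((x / m : ℕ) : ℤ) ^ 2
        + N * (2 * (22 * k * B) ^ 2) := by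
        rw [Finset.sum_add_distrib, ← Finset.mul_sum, Finset.sum_const, Nat.card_Ioc, nsmul_eq_mul]
        congr 3
        omega
    _ ≤ 2 * (m * (1334 * (k : ℝ) ^ 4 * (72 * C₀ * Z * K))) +
        N * (2 * (22 * k * B) ^ 2) := by
        gcongr
        exact hF.trans (by gcongr)
    _ = 2 * 1334 * (k : ℝ) ^ 4 * 72 * C₀ * N * K + N * (2 * (22 * k * B) ^ 2) * 1 := by
        linear_combination (2 * 1334 * (k : ℝ) ^ 4 * 72 * C₀ * K) * hmZ
    _ ≤ 2 * 1334 * (q * P) ^ 4 * 72 * C₀ * N * K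
        + N * (2 * (22 * (q * P) * B) ^ 2) * K := by gcongr
    _ = _ := by rw [hB]; ring

theorem sum_sq_dilatedSum_le_of_range (g : ℕ → ℝ) (hg : EssBdd g) (G θ₁ ϑ η lo hi : ℝ)
    (hG1 : 0 < G) (hG2 : G < 1) (hθ₁ : 0 < θ₁) (hθϑ : θ₁ ≤ ϑ) (hη : 0 < η) (hη1 : η ≤ 1)
    (hϑη : ϑ + η < 1) (hlo : 0 < lo) (hlohi : lo ≤ hi)
    (hyp : ∀ θ : ℝ, θ₁ ≤ θ → θ ≤ ϑ → ∀ c₁ c₂ : ℝ, 0 < c₁ → c₁ < c₂ →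
      ∃ C : ℝ, 0 < C ∧ ∀ M h : ℕ, 0 < M → 0 < h →
        c₁ * (M : ℝ) ^ θ ≤ (h : ℝ) → (h : ℝ) ≤ c₂ * (M : ℝ) ^ θ →
        Jw' g M h ≤ C * (M : ℝ) * (h : ℝ) ^ (2 - G)) :
    ∃ C Z₀ : ℝ, 0 < C ∧ 0 < Z₀ ∧ ∀ N H m : ℕ, 0 < N → 0 < m → Z₀ ≤ (N : ℝ) / m →
      lo * ((N : ℝ) / m) ^ θ₁ ≤ (H : ℝ) / m → (H : ℝ) / m ≤ hi * ((N : ℝ) / m) ^ ϑ →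
      ∑ x ∈ Finset.Ioc N (2 * N), dilatedSum g (6 * N) H m x ^ 2
        ≤ C * N * ((H : ℝ) / m) ^ (2 - G) * (N : ℝ) ^ (4 * η) := by
  have hhi : 0 < hi := by linarith
  have key : ∀ n : ℕ, ∃ C Z₀ : ℝ, 0 < C ∧ 1 ≤ Z₀ ∧ ∀ N H m : ℕ, 0 < N → 0 < m →
      Z₀ ≤ (N : ℝ) / m → lo * ((N : ℝ) / m) ^ θ₁ ≤ (H : ℝ) / m →
      (H : ℝ) / m ≤ hi * ((N : ℝ) / m) ^ min (θ₁ + n * η) ϑ →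
      ∑ x ∈ Finset.Ioc N (2 * N), dilatedSum g (6 * N) H m x ^ 2
        ≤ C * N * ((H : ℝ) / m) ^ (2 - G) * (N : ℝ) ^ (4 * η) := by
    intro n
    induction n with
    | zero =>
      obtain ⟨C, Z₀, hC, _, h⟩ := sum_sq_dilatedSum_le g hg G θ₁ η lo hi hG1 hG2 hθ₁ hη hη1
        (by linarith) hlo hhi (hyp θ₁ le_rfl hθϑ)
      refine ⟨C, max Z₀ 1, hC, le_max_right _ _, fun N H m hN hm hZ hl hu => ?_⟩
      have hZ1 : 1 ≤ (N : ℝ) / m := (le_max_right _ _).trans hZ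
      refine h N H m hN hm ((le_max_left _ _).trans hZ) hl (hu.trans ?_)
      gcongr
      refine (min_le_left _ _).trans ?_
      simp only [Nat.cast_zero]
      linarith
    | succ n ih =>
      obtain ⟨C₁, Z₁, hC₁, hZ₁, h₁⟩ := ih
      have hu1 : θ₁ ≤ min (θ₁ + n * η) ϑ := le_min (by
        have : 0 ≤ (n : ℝ) * η := by positivity
        linarith) hθϑ
      have hu2 : min (θ₁ + n * η) ϑ ≤ ϑ := min_le_right _ _
      obtain ⟨C₂, Z₂, hC₂, _, h₂⟩ := sum_sq_dilatedSum_le g hg G (min (θ₁ + n * η) ϑ) η lo hi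
        hG1 hG2 (by linarith) hη hη1 (by linarith) hlo hhi (hyp _ hu1 hu2)
      refine ⟨max C₁ C₂, max Z₁ Z₂, lt_max_of_lt_left hC₁, le_max_of_le_left hZ₁,
        fun N H m hN hm hZ hl hu => ?_⟩
      have hz1 := (le_max_left _ _).trans hZ
      have hZ1 : 1 ≤ (N : ℝ) / m := hZ₁.trans hz1
      rcases le_total ((H : ℝ) / m) (hi * ((N : ℝ) / m) ^ min (θ₁ + n * η) ϑ) with hc | hc
      · refine (h₁ N H m hN hm hz1 hl hc).trans ?_
        gcongr
        exact le_max_left _ _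
      · refine (h₂ N H m hN hm ((le_max_right _ _).trans hZ) ?_ (hu.trans ?_)).trans ?_
        · refine le_trans ?_ hc
          gcongr
        · gcongr
          rw [min_add, Nat.cast_succ]
          exact min_le_min (by linarith) (by linarith)
        · gcongr
          exact le_max_right _ _
  obtain ⟨n, hn⟩ := exists_nat_ge ((ϑ - θ₁) / η)
  rw [div_le_iff₀ hη] at hn
  obtain ⟨C, Z₀, hC, hZ₀, h⟩ := key n
  rw [min_eq_right (by linarith)] at h
  exact ⟨C, Z₀, hC, by linarith, h⟩

/-- The harmonic number `1 + 1/2 + ⋯ + 1/K` as a real number. -/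
noncomputable def harmonicReal (K : ℕ) : ℝ := ∑ i ∈ Finset.Icc 1 K, 1 / (i : ℝ)

theorem harmonicReal_nonneg (K : ℕ) : 0 ≤ harmonicReal K :=
  Finset.sum_nonneg fun _ _ => by positivity

theorem harmonicReal_le (K : ℕ) : harmonicReal K ≤ 1 + Real.log K := by
  have := harmonic_le_one_add_log K
  rw [harmonic_eq_sum_Icc] at this
  push_cast at this
  simpa [harmonicReal] using this

theorem sum_one_div_le_harmonicReal {ι : Type*} (S : Finset ι) (K : ℕ) (f : ι → ℕ)
    (h1 : ∀ i ∈ S, 1 ≤ f i) (h2 : ∀ i ∈ S, f i ≤ K) (h3 : Set.InjOn f S) :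
    ∑ i ∈ S, 1 / (f i : ℝ) ≤ harmonicReal K := by
  classical
  rw [← Finset.sum_image (g := f) (f := fun i : ℕ => 1 / (i : ℝ)) h3]
  refine Finset.sum_le_sum_of_subset_of_nonneg ?_ fun _ _ _ => by positivity
  intro k hk
  obtain ⟨i, hi, rfl⟩ := Finset.mem_image.1 hk
  exact Finset.mem_Icc.2 ⟨h1 i hi, h2 i hi⟩

theorem sum_one_div_le_of_spaced {ι : Type*} (S : Finset ι) (K : ℕ) (hK : 0 < K) (t : ι → ℝ)
    (h1 : ∀ i ∈ S, 1 / (K : ℝ) ≤ t i) (h2 : ∀ i ∈ S, t i ≤ 1)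
    (h3 : ∀ i ∈ S, ∀ j ∈ S, i ≠ j → 1 / (K : ℝ) ≤ |t i - t j|) :
    ∑ i ∈ S, 1 / t i ≤ K * harmonicReal K := by
  have hKR : (0 : ℝ) < K := by exact_mod_cast hK
  have hpos : ∀ i ∈ S, 0 < t i := fun i hi => lt_of_lt_of_le (by positivity) (h1 i hi)
  have hfl : ∀ i ∈ S, 1 ≤ ⌊K * t i⌋₊ := fun i hi => Nat.one_le_floor_iff _ |>.2 (by
    have := h1 i hi
    rwa [div_le_iff₀' hKR] at this)
  have := sum_one_div_le_harmonicReal S K (fun i => ⌊K * t i⌋₊) hfl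
    (fun i hi => by
      refine (Nat.floor_mono (mul_le_mul_of_nonneg_left (h2 i hi) hKR.le)).trans ?_
      simp)
    (fun i hi j hj hij => by
      by_contra hne
      have h := h3 i hi j hj hne
      rw [div_le_iff₀' hKR] at h
      replace h : 1 ≤ |K * (t i - t j)| := by rwa [abs_mul, abs_of_pos hKR]
      rw [mul_sub] at h
      have a1 := Nat.floor_le (mul_nonneg hKR.le (hpos i hi).le)
      have a2 := Nat.lt_floor_add_one (K * t i)
      have b1 := Nat.floor_le (mul_nonneg hKR.le (hpos j hj).le)
      have b2 := Nat.lt_floor_add_one (K * t j)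
      simp only at hij
      rw [hij] at a1 a2
      exact absurd h (not_le.2 (abs_lt.2 ⟨by linarith, by linarith⟩)))
  calc ∑ i ∈ S, 1 / t i ≤ ∑ i ∈ S, K * (1 / (⌊K * t i⌋₊ : ℝ)) := by
        refine Finset.sum_le_sum fun i hi => ?_
        have hp := hpos i hi
        have hk : (0 : ℝ) < ⌊K * t i⌋₊ := by exact_mod_cast hfl i hi
        rw [mul_one_div, div_le_div_iff₀ hp hk, one_mul]
        exact Nat.floor_le (mul_nonneg hKR.le hp.le)
    _ ≤ K * harmonicReal K := by
        rw [← Finset.mul_sum]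
        gcongr

theorem one_div_sq_le_abs_sub (D : ℕ) (r s : ℚ) (k : ℤ) (hr : r.den ≤ D) (hs : s.den ≤ D)
    (hne : r - s ≠ k) : 1 / ((D ^ 2 : ℕ) : ℝ) ≤ |(r : ℝ) - s - k| := by
  have hrd : (0 : ℚ) < r.den := by exact_mod_cast r.pos
  have hsd : (0 : ℚ) < s.den := by exact_mod_cast s.pos
  have e1 : r * r.den = r.num := Rat.mul_den_eq_num r
  have e2 : s * s.den = s.num := Rat.mul_den_eq_num s
  have hz : ((r.num * s.den - s.num * r.den - k * r.den * s.den : ℤ) : ℚ) =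
      (r - s - k) * (r.den * s.den) := by
    push_cast
    rw [← e1, ← e2]
    ring
  have hz0 : r.num * s.den - s.num * r.den - k * r.den * s.den ≠ 0 := by
    intro h0
    rw [h0, Int.cast_zero, eq_comm, mul_eq_zero] at hz
    rcases hz with hz | hz
    · exact hne (by linarith)
    · exact absurd hz (by positivity)
  have h1 : (1 : ℚ) ≤ |r - s - k| * (r.den * s.den) := by
    rw [← abs_of_pos (mul_pos hrd hsd), ← abs_mul, ← hz]
    exact_mod_cast Int.one_le_abs hz0
  have h2 : (r.den * s.den : ℚ) ≤ (D ^ 2 : ℕ) := by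
    rw [sq]
    exact_mod_cast Nat.mul_le_mul hr hs
  have hD : (0 : ℚ) < (D ^ 2 : ℕ) := lt_of_lt_of_le (by positivity) h2
  have h3 : 1 / ((D ^ 2 : ℕ) : ℚ) ≤ |r - s - k| := by
    rw [div_le_iff₀ hD]
    exact h1.trans (by gcongr)
  have h4 : ((1 / ((D ^ 2 : ℕ) : ℚ) : ℚ) : ℝ) ≤ ((|r - s - k| : ℚ) : ℝ) := Rat.cast_le.2 h3
  push_cast at h4 ⊢
  exact h4

/-- The additive character `t ↦ exp(2πit)`. -/
noncomputable def eC (t : ℝ) : ℂ := Complex.exp ((2 * Real.pi * t : ℝ) * Complex.I)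

theorem eC_add (s t : ℝ) : eC (s + t) = eC s * eC t := by
  rw [eC, eC, eC, ← Complex.exp_add]
  congr 1
  push_cast
  ring

theorem norm_eC (t : ℝ) : ‖eC t‖ = 1 := Complex.norm_exp_ofReal_mul_I _

theorem eC_intCast (n : ℤ) : eC n = 1 := by
  rw [eC, Complex.exp_eq_one_iff]
  exact ⟨n, by push_cast; ring⟩

theorem eC_zero : eC 0 = 1 := by simp [eC]

theorem eC_nat_mul (n : ℕ) (t : ℝ) : eC (n * t) = eC t ^ n := by
  rw [eC, eC, ← Complex.exp_nat_mul]
  congr 1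
  push_cast
  ring

theorem conj_eC (t : ℝ) : (starRingEnd ℂ) (eC t) = eC (-t) := by
  rw [eC, eC, ← Complex.exp_conj, map_mul, Complex.conj_I, Complex.conj_ofReal]
  congr 1
  push_cast
  ring

theorem eC_fract (t : ℝ) : eC (Int.fract t) = eC t := by
  have : eC t = eC (Int.fract t + ⌊t⌋) := by rw [Int.fract_add_floor]
  rw [this, eC_add, eC_intCast, mul_one]

theorem four_mul_min_le_norm_one_sub_eC (t : ℝ) (h0 : 0 ≤ t) (h1 : t ≤ 1) :
    4 * min t (1 - t) ≤ ‖1 - eC t‖ := by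
  have e : ‖1 - eC t‖ = ‖2 * Real.sin (2 * Real.pi * t / 2)‖ := by
    rw [norm_sub_rev, ← Complex.norm_exp_I_mul_ofReal_sub_one, eC, mul_comm]
  rw [e, Real.norm_eq_abs]
  refine le_trans ?_ (le_abs_self _)
  have hpi := Real.pi_pos
  rw [show 2 * Real.pi * t / 2 = Real.pi * t by ring]
  rcases le_total t (1 / 2) with h | h
  · have := Real.mul_le_sin (x := Real.pi * t) (by positivity) (by nlinarith)
    rw [show 2 / Real.pi * (Real.pi * t) = 2 * t by field_simp] at this
    have := min_le_left t (1 - t)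
    linarith
  · have := Real.mul_le_sin (x := Real.pi * (1 - t)) (by nlinarith) (by nlinarith)
    rw [show 2 / Real.pi * (Real.pi * (1 - t)) = 2 * (1 - t) by field_simp,
      show Real.pi * (1 - t) = Real.pi - Real.pi * t by ring, Real.sin_pi_sub] at this
    have := min_le_right t (1 - t)
    linarith

theorem norm_one_sub_eC_pos (t : ℝ) (h0 : 0 < t) (h1 : t < 1) : 0 < ‖1 - eC t‖ :=
  lt_of_lt_of_le (by have := lt_min h0 (sub_pos.2 h1); linarith)
    (four_mul_min_le_norm_one_sub_eC t h0.le h1.le)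

theorem one_div_norm_one_sub_eC_le (t : ℝ) (h0 : 0 < t) (h1 : t < 1) :
    1 / ‖1 - eC t‖ ≤ (1 / t + 1 / (1 - t)) / 4 := by
  have hm : 0 < min t (1 - t) := lt_min h0 (by linarith)
  have h2 : 0 < 1 - t := by linarith
  calc 1 / ‖1 - eC t‖ ≤ 1 / (4 * min t (1 - t)) :=
        one_div_le_one_div_of_le (by positivity) (four_mul_min_le_norm_one_sub_eC t h0.le h1.le)
    _ = (1 / min t (1 - t)) / 4 := by field_simp
    _ ≤ _ := by
        gcongr
        rcases min_choice t (1 - t) with h | h <;> rw [h]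
        · have : 0 < 1 / (1 - t) := by positivity
          linarith
        · have : 0 < 1 / t := by positivity
          linarith

theorem norm_sum_Ioc_pow_le (z : ℂ) (hz : ‖z‖ = 1) (hz1 : 0 < ‖1 - z‖) (a b : ℕ) (hab : a ≤ b) :
    ‖∑ x ∈ Finset.Ioc a b, z ^ x‖ ≤ 2 / ‖1 - z‖ := by
  have hne : z ≠ 1 := by
    rintro rfl
    simp at hz1
  have h : Finset.Ioc a b = Finset.Ico (a + 1) (b + 1) := by
    ext x
    simp only [Finset.mem_Ioc, Finset.mem_Ico]
    omega
  rw [h, geom_sum_Ico hne (by omega), norm_div, norm_sub_rev z 1]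
  gcongr
  refine (norm_sub_le _ _).trans ?_
  rw [norm_pow, norm_pow, hz]
  norm_num

theorem norm_sum_Ioc_eC_le (N : ℕ) (t : ℝ) (h0 : 0 < Int.fract t) :
    ‖∑ x ∈ Finset.Ioc N (2 * N), eC (x * t)‖ ≤
      (1 / Int.fract t + 1 / (1 - Int.fract t)) / 2 := by
  have h1 := Int.fract_lt_one t
  have h2 := norm_one_sub_eC_pos _ h0 h1
  have h3 := one_div_norm_one_sub_eC_le _ h0 h1
  have h4 := norm_sum_Ioc_pow_le (eC (Int.fract t)) (norm_eC _) h2 N (2 * N) (by omega)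
  simp only [eC_nat_mul]
  rw [eC_fract] at h3 h4
  refine h4.trans ?_
  rw [show 2 / ‖1 - eC t‖ = 2 * (1 / ‖1 - eC t‖) by ring]
  linarith

theorem sum_norm_sq_le_of_row_sum_le {ι κ : Type*} (P : Finset ι) (X : Finset κ)
    (u : ι → κ → ℂ) (c : ι → ℂ) (B : ℝ)
    (hB : ∀ r ∈ P, ∑ s ∈ P, ‖∑ x ∈ X, u r x * (starRingEnd ℂ) (u s x)‖ ≤ B) :
    ∑ x ∈ X, ‖∑ r ∈ P, c r * u r x‖ ^ 2 ≤ B * ∑ r ∈ P, ‖c r‖ ^ 2 := by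
  set Φ : ι → ι → ℂ := fun r s => ∑ x ∈ X, u r x * (starRingEnd ℂ) (u s x) with hΦ
  have hsymm : ∀ r s, ‖Φ r s‖ = ‖Φ s r‖ := by
    intro r s
    rw [← RCLike.norm_conj (Φ s r)]
    congr 1
    simp only [hΦ, map_sum, map_mul, Complex.conj_conj]
    exact Finset.sum_congr rfl fun _ _ => mul_comm _ _
  have h1 : ((∑ x ∈ X, ‖∑ r ∈ P, c r * u r x‖ ^ 2 : ℝ) : ℂ) =
      ∑ r ∈ P, ∑ s ∈ P, c r * (starRingEnd ℂ) (c s) * Φ r s := by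
    push_cast
    simp only [← Complex.mul_conj', map_sum, Finset.sum_mul_sum]
    simp only [hΦ, Finset.mul_sum]
    rw [Finset.sum_comm]
    refine Finset.sum_congr rfl fun r _ => ?_
    rw [Finset.sum_comm]
    refine Finset.sum_congr rfl fun s _ => Finset.sum_congr rfl fun x _ => ?_
    rw [map_mul]
    ring
  have h2 : ∑ x ∈ X, ‖∑ r ∈ P, c r * u r x‖ ^ 2 ≤
      ∑ r ∈ P, ∑ s ∈ P, ‖c r‖ * ‖c s‖ * ‖Φ r s‖ := by
    have h3 := congrArg norm h1
    rw [Complex.norm_real, Real.norm_of_nonneg (Finset.sum_nonneg fun _ _ => by positivity)] at h3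
    rw [h3]
    refine (norm_sum_le _ _).trans (Finset.sum_le_sum fun r _ => (norm_sum_le _ _).trans ?_)
    refine Finset.sum_le_sum fun s _ => ?_
    rw [norm_mul, norm_mul, RCLike.norm_conj]
  have h4 : ∑ r ∈ P, ∑ s ∈ P, ‖c r‖ ^ 2 * ‖Φ r s‖ ≤ B * ∑ r ∈ P, ‖c r‖ ^ 2 := by
    rw [Finset.mul_sum]
    refine Finset.sum_le_sum fun r hr => ?_
    rw [← Finset.mul_sum, mul_comm]
    exact mul_le_mul_of_nonneg_right (hB r hr) (by positivity)
  have h5 : ∑ r ∈ P, ∑ s ∈ P, ‖c s‖ ^ 2 * ‖Φ r s‖ = ∑ r ∈ P, ∑ s ∈ P, ‖c r‖ ^ 2 * ‖Φ r s‖ := by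
    rw [Finset.sum_comm]
    exact Finset.sum_congr rfl fun r _ => Finset.sum_congr rfl fun s _ => by rw [hsymm]
  have h6 : ∑ r ∈ P, ∑ s ∈ P, ‖c r‖ * ‖c s‖ * ‖Φ r s‖ ≤
      ∑ r ∈ P, ∑ s ∈ P, (‖c r‖ ^ 2 * ‖Φ r s‖ + ‖c s‖ ^ 2 * ‖Φ r s‖) / 2 := by
    refine Finset.sum_le_sum fun r _ => Finset.sum_le_sum fun s _ => ?_
    nlinarith [mul_nonneg (sq_nonneg (‖c r‖ - ‖c s‖)) (norm_nonneg (Φ r s))]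
  simp only [← Finset.sum_div, Finset.sum_add_distrib] at h6
  rw [h5] at h6
  linarith

theorem sub_ne_intCast_of_mem_Ioo (r s : ℚ) (hr : r ∈ Set.Ioo (0 : ℚ) 1)
    (hs : s ∈ Set.Ioo (0 : ℚ) 1) (hrs : r ≠ s) (k : ℤ) : r - s ≠ k := by
  intro h
  have h1 : (k : ℚ) < 1 := by rw [← h]; linarith [hr.2, hs.1]
  have h2 : (-1 : ℚ) < k := by rw [← h]; linarith [hr.1, hs.2]
  have h3 : k < 1 := by exact_mod_cast h1
  have h4 : -1 < k := by exact_mod_cast h2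
  have h5 : k = 0 := by omega
  rw [h5, Int.cast_zero, sub_eq_zero] at h
  exact hrs h

theorem sum_norm_sum_eC_sub_le (P : Finset ℚ) (D N : ℕ) (hD : 0 < D)
    (hP : ∀ r ∈ P, r ∈ Set.Ioo (0 : ℚ) 1 ∧ r.den ≤ D) (r : ℚ) (hr : r ∈ P) :
    ∑ s ∈ P, ‖∑ x ∈ Finset.Ioc N (2 * N), eC (x * ((r : ℝ) - s))‖ ≤
      N + (D ^ 2 : ℕ) * harmonicReal (D ^ 2) := by
  have hK : 0 < D ^ 2 := by positivity
  have hlow : ∀ s ∈ P.erase r, 1 / ((D ^ 2 : ℕ) : ℝ) ≤ Int.fract ((r : ℝ) - s) ∧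
      1 / ((D ^ 2 : ℕ) : ℝ) ≤ 1 - Int.fract ((r : ℝ) - s) := by
    intro s hs
    obtain ⟨hne, hs⟩ := Finset.mem_erase.1 hs
    have hn := fun k => sub_ne_intCast_of_mem_Ioo r s (hP r hr).1 (hP s hs).1 hne.symm k
    have h1 := one_div_sq_le_abs_sub D r s ⌊(r : ℝ) - s⌋ (hP r hr).2 (hP s hs).2 (hn _)
    have h2 := one_div_sq_le_abs_sub D r s (⌊(r : ℝ) - s⌋ + 1) (hP r hr).2 (hP s hs).2 (hn _)
    rw [abs_of_nonneg (by linarith [Int.floor_le ((r : ℝ) - s)])] at h1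
    rw [abs_of_nonpos (by push_cast; linarith [Int.lt_floor_add_one ((r : ℝ) - s)])] at h2
    push_cast at h2
    rw [Int.fract]
    push_cast
    push_cast at h1
    exact ⟨by linarith, by linarith⟩
  have hsp : ∀ s ∈ P.erase r, ∀ s' ∈ P.erase r, s ≠ s' →
      1 / ((D ^ 2 : ℕ) : ℝ) ≤ |Int.fract ((r : ℝ) - s) - Int.fract ((r : ℝ) - s')| := by
    intro s hs s' hs' hne
    have h1 := one_div_sq_le_abs_sub D s' s (⌊(r : ℝ) - s⌋ - ⌊(r : ℝ) - s'⌋)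
      (hP s' (Finset.mem_of_mem_erase hs')).2 (hP s (Finset.mem_of_mem_erase hs)).2
      (sub_ne_intCast_of_mem_Ioo s' s (hP s' (Finset.mem_of_mem_erase hs')).1
        (hP s (Finset.mem_of_mem_erase hs)).1 hne.symm _)
    refine h1.trans (le_of_eq ?_)
    congr 1
    rw [Int.fract, Int.fract]
    push_cast
    ring
  have hA := sum_one_div_le_of_spaced (P.erase r) (D ^ 2) hK (fun s => Int.fract ((r : ℝ) - s))
    (fun s hs => (hlow s hs).1) (fun s _ => (Int.fract_lt_one _).le) hsp
  have hB := sum_one_div_le_of_spaced (P.erase r) (D ^ 2) hK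
    (fun s => 1 - Int.fract ((r : ℝ) - s)) (fun s hs => (hlow s hs).2)
    (fun s _ => by linarith [Int.fract_nonneg ((r : ℝ) - s)])
    (fun s hs s' hs' hne => by
      rw [sub_sub_sub_cancel_left]
      exact hsp s' hs' s hs hne.symm)
  rw [← Finset.add_sum_erase P _ hr]
  refine add_le_add ?_ ?_
  · simp only [sub_self, mul_zero, eC_zero, Finset.sum_const, Nat.card_Ioc]
    rw [show 2 * N - N = N by omega]
    simp
  · calc ∑ s ∈ P.erase r, ‖∑ x ∈ Finset.Ioc N (2 * N), eC (x * ((r : ℝ) - s))‖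
        ≤ ∑ s ∈ P.erase r, (1 / Int.fract ((r : ℝ) - s) + 1 / (1 - Int.fract ((r : ℝ) - s))) / 2 :=
          Finset.sum_le_sum fun s hs => norm_sum_Ioc_eC_le N _
            (lt_of_lt_of_le (by positivity) (hlow s hs).1)
      _ ≤ _ := by
          rw [← Finset.sum_div, Finset.sum_add_distrib]
          linarith

/-- The large sieve inequality for fractions with denominators at most `D`, up to a logarithm. -/
theorem sum_norm_sq_sum_eC_le (P : Finset ℚ) (D N : ℕ) (hD : 0 < D)
    (hP : ∀ r ∈ P, r ∈ Set.Ioo (0 : ℚ) 1 ∧ r.den ≤ D) (c : ℚ → ℂ) :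
    ∑ x ∈ Finset.Ioc N (2 * N), ‖∑ r ∈ P, c r * eC (x * (r : ℝ))‖ ^ 2 ≤
      (N + (D ^ 2 : ℕ) * harmonicReal (D ^ 2)) * ∑ r ∈ P, ‖c r‖ ^ 2 := by
  refine sum_norm_sq_le_of_row_sum_le P _ (fun (r : ℚ) (x : ℕ) => eC (x * (r : ℝ))) c _
    fun r hr => ?_
  refine le_trans (le_of_eq ?_) (sum_norm_sum_eC_sub_le P D N hD hP r hr)
  refine Finset.sum_congr rfl fun s _ => ?_
  congr 1
  refine Finset.sum_congr rfl fun x _ => ?_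
  rw [conj_eC, ← eC_add]
  congr 1
  ring

theorem abs_wH'_le (H : ℕ) (hH : 0 < H) (a : ℤ) : |wH' H a| ≤ 1 := by
  rw [wH'_eq_triStep]
  exact abs_triStep_le _ _ (by exact_mod_cast hH)

theorem wH'_eq_zero (H : ℕ) (hH : 0 < H) (a : ℤ) (ha : (H : ℤ) < |a|) : wH' H a = 0 := by
  rw [wH'_eq_triStep]
  exact triStep_eq_zero _ _ (by exact_mod_cast hH) (by exact_mod_cast ha)

theorem abs_wH'_sub_pred_le (H : ℕ) (hH : 0 < H) (a : ℤ) :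
    |wH' H a - wH' H (a - 1)| ≤
      1 / H + ((if a = 1 then 1 else 0) + if a = H + 1 then 1 else 0) := by
  have hHR : (0 : ℝ) < H := by exact_mod_cast hH
  have h1 : |cesaroH H a - cesaroH H (a - 1)| ≤ 1 / H := by
    rw [cesaroH, cesaroH]
    refine (abs_max_sub_max_le_abs _ _ _).trans ?_
    rw [sub_sub_sub_cancel_left, ← sub_div, abs_div, abs_of_pos hHR]
    gcongr
    refine (abs_abs_sub_abs_le_abs_sub _ _).trans ?_
    push_cast
    rw [show (a : ℝ) - 1 - a = -1 by ring]
    simp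
  have h2 : |uH H a - uH H (a - 1)| ≤
      (if a = 1 then 1 else 0) + if a = (H : ℤ) + 1 then 1 else 0 := by
    rw [uH, uH]
    split_ifs <;> first | omega | norm_num
  rw [wH', wH', show cesaroH H a - uH H a - (cesaroH H (a - 1) - uH H (a - 1)) =
    (cesaroH H a - cesaroH H (a - 1)) - (uH H a - uH H (a - 1)) by ring]
  exact (abs_sub _ _).trans (add_le_add h1 h2)

/-- The Fourier transform of the weight `w′_H`. -/
noncomputable def wHat (H : ℕ) (t : ℝ) : ℂ :=
  ∑ a ∈ Finset.Icc (-H : ℤ) H, (wH' H a : ℂ) * eC (a * t)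

theorem norm_wHat_le (H : ℕ) (hH : 0 < H) (t : ℝ) : ‖wHat H t‖ ≤ 3 * H := by
  have hHR : (1 : ℝ) ≤ H := by exact_mod_cast hH
  refine (norm_sum_le _ _).trans ?_
  calc ∑ a ∈ Finset.Icc (-H : ℤ) H, ‖(wH' H a : ℂ) * eC (a * t)‖
      ≤ ∑ a ∈ Finset.Icc (-H : ℤ) H, (1 : ℝ) := by
        refine Finset.sum_le_sum fun a _ => ?_
        rw [norm_mul, norm_eC, mul_one, Complex.norm_real, Real.norm_eq_abs]
        exact abs_wH'_le H hH a
    _ = 2 * H + 1 := by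
        rw [Finset.sum_const, Int.card_Icc, nsmul_eq_mul, mul_one]
        have : (((H : ℤ) + 1 - -(H : ℤ)).toNat) = 2 * H + 1 := by omega
        rw [this]
        push_cast
        ring
    _ ≤ 3 * H := by linarith

theorem wHat_mul_one_sub_eC (H : ℕ) (hH : 0 < H) (t : ℝ) :
    wHat H t * (1 - eC t) =
      ∑ a ∈ Finset.Icc (-H : ℤ) (H + 1), ((wH' H a - wH' H (a - 1) : ℝ) : ℂ) * eC (a * t) := by
  have h1 : wHat H t = ∑ a ∈ Finset.Icc (-H : ℤ) (H + 1), (wH' H a : ℂ) * eC (a * t) := by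
    refine Finset.sum_subset (Finset.Icc_subset_Icc le_rfl (by omega)) fun a ha hna => ?_
    rw [Finset.mem_Icc] at ha hna
    rw [wH'_eq_zero H hH a (by rw [abs_of_pos] <;> omega)]
    simp
  have h2 : wHat H t * eC t =
      ∑ a ∈ Finset.Icc (-H : ℤ) (H + 1), (wH' H (a - 1) : ℂ) * eC (a * t) := by
    have h3 : ∑ a ∈ Finset.Icc (-H : ℤ) (H + 1), (wH' H (a - 1) : ℂ) * eC (a * t) =
        ∑ a ∈ Finset.Icc (-H + 1 : ℤ) (H + 1), (wH' H (a - 1) : ℂ) * eC (a * t) := by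
      symm
      refine Finset.sum_subset (Finset.Icc_subset_Icc (by omega) le_rfl) fun a ha hna => ?_
      rw [Finset.mem_Icc] at ha hna
      rw [wH'_eq_zero H hH (a - 1) (by rw [abs_of_neg] <;> omega)]
      simp
    rw [h3, wHat, Finset.sum_mul]
    refine Finset.sum_nbij' (· + 1) (· - 1) ?_ ?_ ?_ ?_ ?_
    · intro a ha
      rw [Finset.mem_Icc] at ha ⊢
      omega
    · intro a ha
      rw [Finset.mem_Icc] at ha ⊢
      omega
    · intro a _
      simp
    · intro a _
      simp
    · intro a _
      rw [add_sub_cancel_right, mul_assoc, ← eC_add]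
      congr 2
      push_cast
      ring
  rw [mul_sub, mul_one, h2, h1, ← Finset.sum_sub_distrib]
  refine Finset.sum_congr rfl fun a _ => ?_
  push_cast
  ring

theorem norm_wHat_mul_le (H : ℕ) (hH : 0 < H) (t : ℝ) : ‖wHat H t‖ * ‖1 - eC t‖ ≤ 6 := by
  have hHR : (1 : ℝ) ≤ H := by exact_mod_cast hH
  rw [← norm_mul, wHat_mul_one_sub_eC H hH]
  refine (norm_sum_le _ _).trans ?_
  calc ∑ a ∈ Finset.Icc (-H : ℤ) (H + 1), ‖((wH' H a - wH' H (a - 1) : ℝ) : ℂ) * eC (a * t)‖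
      ≤ ∑ a ∈ Finset.Icc (-H : ℤ) (H + 1), (1 / (H : ℝ) +
          ((if a = 1 then 1 else 0) + if a = H + 1 then 1 else 0)) := by
        refine Finset.sum_le_sum fun a _ => ?_
        rw [norm_mul, norm_eC, mul_one, Complex.norm_real, Real.norm_eq_abs]
        exact abs_wH'_sub_pred_le H hH a
    _ ≤ (2 * H + 2) * (1 / H) + (1 + 1) := by
        rw [Finset.sum_add_distrib, Finset.sum_add_distrib, Finset.sum_const, Int.card_Icc,
          nsmul_eq_mul, Finset.sum_ite_eq', Finset.sum_ite_eq']
        have : (((H : ℤ) + 1 + 1 - -(H : ℤ)).toNat) = 2 * H + 2 := by omega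
        rw [this]
        push_cast
        gcongr <;> split_ifs <;> norm_num
    _ ≤ 6 := by
        have : (2 * (H : ℝ) + 2) * (1 / H) ≤ 4 := by
          rw [mul_one_div, div_le_iff₀ (by linarith)]
          linarith
        linarith

theorem norm_sq_wHat_le (H : ℕ) (hH : 0 < H) (t : ℝ) (h0 : 0 < t) (h1 : t < 1) :
    ‖wHat H t‖ ^ 2 ≤ 5 * H * (1 / t + 1 / (1 - t)) := by
  have hs := norm_one_sub_eC_pos t h0 h1
  have h2 := one_div_norm_one_sub_eC_le t h0 h1
  have h3 : ‖wHat H t‖ ≤ 6 * (1 / ‖1 - eC t‖) := by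
    rw [mul_one_div, le_div_iff₀ hs]
    exact norm_wHat_mul_le H hH t
  have h4 := norm_wHat_le H hH t
  have h5 : ‖wHat H t‖ ≤ 6 * ((1 / t + 1 / (1 - t)) / 4) := by linarith
  have h6 : 0 ≤ 1 / t + 1 / (1 - t) := by
    have : 0 < 1 - t := by linarith
    positivity
  calc ‖wHat H t‖ ^ 2 = ‖wHat H t‖ * ‖wHat H t‖ := sq _
    _ ≤ 3 * H * (6 * ((1 / t + 1 / (1 - t)) / 4)) := by gcongr
    _ ≤ _ := by nlinarith [mul_nonneg (Nat.cast_nonneg (α := ℝ) H) h6]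

theorem sum_wH' (H : ℕ) (hH : 0 < H) : ∑ a ∈ Finset.Icc (-H : ℤ) H, wH' H a = 0 := by
  have hHR : (0 : ℝ) < H := by exact_mod_cast hH
  have hpair : ∀ a ∈ Finset.Icc (1 : ℤ) H, wH' H (a - H) + wH' H a = 0 := by
    intro a ha
    rw [Finset.mem_Icc] at ha
    have h1 : (0 : ℝ) < a := by exact_mod_cast ha.1
    have h2 : (a : ℝ) ≤ H := by exact_mod_cast ha.2
    have h3 : (a : ℝ) / H ≤ 1 := (div_le_one hHR).2 h2
    have h4 : 0 ≤ (a : ℝ) / H := by positivity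
    rw [wH', wH', cesaroH, cesaroH, uH, uH, if_neg (by omega), if_pos (by omega), abs_of_pos h1,
      Int.cast_sub, Int.cast_natCast, abs_of_nonpos (by linarith), neg_sub, sub_div,
      div_self hHR.ne', max_eq_left (by linarith), max_eq_left (by linarith)]
    ring
  have hsplit : Finset.Icc (-H : ℤ) H =
      insert (-H : ℤ) ((Finset.Icc (1 : ℤ) H).image (· - (H : ℤ)) ∪ Finset.Icc (1 : ℤ) H) := by
    ext a
    simp only [Finset.mem_insert, Finset.mem_union, Finset.mem_image, Finset.mem_Icc]
    constructor
    · intro h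
      rcases eq_or_ne a (-H) with h0 | h0
      · exact Or.inl h0
      · rcases le_or_gt a 0 with h1 | h1
        · exact Or.inr (Or.inl ⟨a + H, by omega, by omega⟩)
        · exact Or.inr (Or.inr (by omega))
    · rintro (h | ⟨b, hb, rfl⟩ | h) <;> omega
  have hedge : wH' H (-H : ℤ) = 0 := by
    rw [wH', cesaroH, uH, if_neg (by omega), Int.cast_neg, Int.cast_natCast, abs_neg,
      abs_of_pos hHR, div_self hHR.ne']
    simp
  rw [hsplit, Finset.sum_insert, Finset.sum_union, Finset.sum_image, ← Finset.sum_add_distrib,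
    Finset.sum_congr rfl hpair, hedge]
  · simp
  · intro a _ b _ h
    simpa using h
  · rw [Finset.disjoint_left]
    intro a ha hb
    obtain ⟨c, hc, rfl⟩ := Finset.mem_image.1 ha
    rw [Finset.mem_Icc] at hb hc
    omega
  · simp only [Finset.mem_union, Finset.mem_image, Finset.mem_Icc, not_or, not_exists]
    exact ⟨fun c hc => by omega, by omega⟩

theorem wHat_zero (H : ℕ) (hH : 0 < H) : wHat H 0 = 0 := by
  have := sum_wH' H hH
  simp only [wHat, mul_zero, eC_zero, mul_one]
  exact_mod_cast this

theorem sum_eC_div (d : ℕ) (hd : 0 < d) (y : ℤ) :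
    ∑ j ∈ Finset.range d, eC (j * ((y : ℝ) / d)) = if (d : ℤ) ∣ y then (d : ℂ) else 0 := by
  have hdR : (d : ℝ) ≠ 0 := by exact_mod_cast hd.ne'
  simp only [eC_nat_mul]
  split_ifs with h
  · obtain ⟨k, rfl⟩ := h
    have : ((((d : ℤ) * k : ℤ) : ℝ) / d) = (k : ℤ) := by
      push_cast
      field_simp
    rw [this, eC_intCast]
    simp
  · have hz : eC ((y : ℝ) / d) ≠ 1 := by
      intro h1
      rw [eC, Complex.exp_eq_one_iff] at h1
      obtain ⟨n, hn⟩ := h1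
      have hpi : (2 * Real.pi : ℂ) * Complex.I ≠ 0 := Complex.two_pi_I_ne_zero
      have h2 : (((y : ℝ) / d : ℝ) : ℂ) = ((n : ℝ) : ℂ) := by
        apply mul_right_cancel₀ hpi
        push_cast at hn ⊢
        linear_combination hn
      have h3 : (y : ℝ) / d = n := by exact_mod_cast h2
      rw [div_eq_iff hdR] at h3
      have h4 : y = n * d := by exact_mod_cast h3
      exact h ⟨n, by rw [h4, mul_comm]⟩
    rw [geom_sum_eq hz, ← eC_nat_mul, mul_div_cancel₀ _ hdR, eC_intCast]
    simp

theorem sum_wH'_mul_sub (H d x R : ℕ) (hH : 0 < H) (hd : 0 < d) (hx : H < x) (hR : x + H ≤ R) :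
    ∑ m ∈ Finset.Icc 1 R, wH' H (((d * m : ℕ) : ℤ) - x) =
      ∑ a ∈ Finset.Icc (-H : ℤ) H, if (d : ℤ) ∣ x + a then wH' H a else 0 := by
  rw [← Finset.sum_filter]
  have h1 : ∑ m ∈ Finset.Icc 1 R, wH' H (((d * m : ℕ) : ℤ) - x) =
      ∑ m ∈ (Finset.Icc 1 R).filter fun m => |((d * m : ℕ) : ℤ) - x| ≤ H,
        wH' H (((d * m : ℕ) : ℤ) - x) := by
    symm
    refine Finset.sum_subset (Finset.filter_subset _ _) fun m hm hnm => ?_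
    rw [Finset.mem_filter, not_and, not_le] at hnm
    exact wH'_eq_zero H hH _ (hnm hm)
  rw [h1]
  refine Finset.sum_nbij (fun m => ((d * m : ℕ) : ℤ) - x) ?_ ?_ ?_ fun _ _ => rfl
  · intro m hm
    rw [Finset.mem_filter, abs_le] at hm
    rw [Finset.mem_filter, Finset.mem_Icc]
    refine ⟨hm.2, ⟨m, ?_⟩⟩
    push_cast
    ring
  · intro m _ m' _ h
    have h2 : ((d * m : ℕ) : ℤ) = ((d * m' : ℕ) : ℤ) := by
      simp only at h
      omega
    exact Nat.eq_of_mul_eq_mul_left hd (by exact_mod_cast h2)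
  · intro a ha
    rw [Finset.mem_coe, Finset.mem_filter, Finset.mem_Icc] at ha
    obtain ⟨⟨ha1, ha2⟩, k, hk⟩ := ha
    have hdZ : (0 : ℤ) < d := by exact_mod_cast hd
    have hk0 : 0 < k := by
      by_contra hneg
      have : (d : ℤ) * k ≤ 0 := mul_nonpos_of_nonneg_of_nonpos hdZ.le (by omega)
      omega
    have hkR : k ≤ R := by
      have : k ≤ d * k := by nlinarith
      omega
    lift k to ℕ using hk0.le
    refine ⟨k, ?_, ?_⟩
    · rw [Finset.mem_coe, Finset.mem_filter, Finset.mem_Icc, abs_le]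
      push_cast
      rw [← hk]
      refine ⟨⟨by omega, by omega⟩, by omega, by omega⟩
    · push_cast
      omega

theorem sum_wH'_mul_sub_eq_wHat (H d x R : ℕ) (hH : 0 < H) (hd : 0 < d) (hx : H < x)
    (hR : x + H ≤ R) :
    ((∑ m ∈ Finset.Icc 1 R, wH' H (((d * m : ℕ) : ℤ) - x) : ℝ) : ℂ) =
      ∑ j ∈ Finset.Ico 1 d, 1 / (d : ℂ) * wHat H ((j : ℝ) / d) * eC (x * ((j : ℝ) / d)) := by
  have hdC : (d : ℂ) ≠ 0 := by exact_mod_cast hd.ne'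
  have h0 : ∑ j ∈ Finset.Ico 1 d, 1 / (d : ℂ) * wHat H ((j : ℝ) / d) * eC (x * ((j : ℝ) / d)) =
      ∑ j ∈ Finset.range d, 1 / (d : ℂ) * wHat H ((j : ℝ) / d) * eC (x * ((j : ℝ) / d)) := by
    rw [Finset.range_eq_Ico, Finset.sum_eq_sum_Ico_succ_bot hd]
    simp [wHat_zero H hH]
  rw [sum_wH'_mul_sub H d x R hH hd hx hR, h0]
  push_cast
  simp only [wHat, Finset.mul_sum, Finset.sum_mul]
  rw [Finset.sum_comm]
  refine Finset.sum_congr rfl fun a _ => ?_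
  have h1 : ∀ j ∈ Finset.range d, 1 / (d : ℂ) * ((wH' H a : ℂ) * eC (a * ((j : ℝ) / d))) *
      eC (x * ((j : ℝ) / d)) =
      (1 / (d : ℂ) * (wH' H a : ℂ)) * eC (j * (((x + a : ℤ) : ℝ) / d)) := by
    intro j _
    rw [show (j : ℝ) * (((x + a : ℤ) : ℝ) / d) = a * ((j : ℝ) / d) + x * ((j : ℝ) / d) by
      push_cast; ring, eC_add]
    ring
  rw [Finset.sum_congr rfl h1, ← Finset.mul_sum, sum_eC_div d hd]
  split_ifs
  · field_simp
  · simp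

theorem natCast_div_den_dvd (j d : ℕ) : ((j : ℚ) / d).den ∣ d := by
  have h := Rat.den_dvd (j : ℤ) (d : ℤ)
  rw [Rat.divInt_eq_div, Int.cast_natCast, Int.cast_natCast] at h
  exact Int.natCast_dvd_natCast.1 h

/-- The fractions `j / d` in `(0, 1)` with `d ≤ D`. -/
def properFractions (D : ℕ) : Finset ℚ :=
  ((Finset.Icc 1 D).sigma fun d => Finset.Ico 1 d).image fun p => (p.2 : ℚ) / p.1

theorem den_le_of_mem_properFractions (D : ℕ) (r : ℚ) (hr : r ∈ properFractions D) :
    r ∈ Set.Ioo (0 : ℚ) 1 ∧ r.den ≤ D := by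
  obtain ⟨⟨d, j⟩, hp, rfl⟩ := Finset.mem_image.1 hr
  rw [Finset.mem_sigma, Finset.mem_Icc, Finset.mem_Ico] at hp
  obtain ⟨⟨hd1, hdD⟩, hj1, hjd⟩ := hp
  simp only at hd1 hdD hj1 hjd
  have hd0 : (0 : ℚ) < d := by exact_mod_cast hd1
  have hj0 : (0 : ℚ) < j := by exact_mod_cast hj1
  have hjd' : (j : ℚ) < d := by exact_mod_cast hjd
  refine ⟨⟨by positivity, (div_lt_one hd0).2 hjd'⟩, ?_⟩
  exact (Nat.le_of_dvd hd1 (natCast_div_den_dvd j d)).trans hdD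

theorem sum_one_div_fiber_le (D : ℕ) (r : ℚ) :
    ∑ p ∈ ((Finset.Icc 1 D).sigma fun d => Finset.Ico 1 d) with (p.2 : ℚ) / p.1 = r,
      1 / (p.1 : ℝ) ≤ harmonicReal D / r.den := by
  have hden : (0 : ℝ) < r.den := by exact_mod_cast r.pos
  set S := ((Finset.Icc 1 D).sigma fun d => Finset.Ico 1 d).filter
    fun p => (p.2 : ℚ) / p.1 = r with hS
  have hmem : ∀ p ∈ S, (0 < p.1 ∧ p.1 ≤ D) ∧ r.den ∣ p.1 ∧ (p.2 : ℚ) = r * p.1 := by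
    intro p hp
    rw [hS, Finset.mem_filter, Finset.mem_sigma, Finset.mem_Icc] at hp
    obtain ⟨⟨⟨h1, h2⟩, _⟩, h3⟩ := hp
    have hd0 : (p.1 : ℚ) ≠ 0 := by exact_mod_cast (show p.1 ≠ 0 by omega)
    refine ⟨⟨h1, h2⟩, ?_, by rw [← h3]; field_simp⟩
    rw [← h3]
    exact natCast_div_den_dvd p.2 p.1
  rw [div_eq_mul_one_div, mul_comm]
  refine le_trans (le_of_eq ?_) (mul_le_mul_of_nonneg_left (sum_one_div_le_harmonicReal S D
    (fun p : (_ : ℕ) × ℕ => p.1 / r.den) (fun p hp => ?_) (fun p hp => ?_) ?_) (by positivity))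
  · rw [Finset.mul_sum]
    refine Finset.sum_congr rfl fun p hp => ?_
    rw [Nat.cast_div (hmem p hp).2.1 hden.ne']
    have := (hmem p hp).1.1
    field_simp
  · exact Nat.div_pos (Nat.le_of_dvd (hmem p hp).1.1 (hmem p hp).2.1) r.pos
  · exact (Nat.div_le_self _ _).trans (hmem p hp).1.2
  · intro p hp q hq hpq
    obtain ⟨_, h1, h2⟩ := hmem p hp
    obtain ⟨_, h3, h4⟩ := hmem q hq
    have h5 : p.1 = q.1 := by
      rw [← Nat.div_mul_cancel h1, ← Nat.div_mul_cancel h3]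
      simp only at hpq
      rw [hpq]
    have h6 : p.2 = q.2 := by
      rw [h5, ← h4] at h2
      exact_mod_cast h2
    exact Sigma.ext h5 (heq_of_eq h6)

theorem sum_properFractions_le (D : ℕ) (a : ℚ → ℕ)
    (ha : ∀ r ∈ properFractions D, 1 ≤ a r ∧ a r ≤ D)
    (hinj : ∀ r ∈ properFractions D, ∀ s ∈ properFractions D, r.den = s.den → a r = a s → r = s) :
    ∑ r ∈ properFractions D, 1 / ((a r : ℝ) * r.den) ≤ harmonicReal D ^ 2 := by
  rw [sq, harmonicReal, Finset.sum_mul_sum, ← Finset.sum_product']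
  rw [← Finset.sum_image (g := fun r : ℚ => (a r, r.den))
    (f := fun p : ℕ × ℕ => 1 / ((p.1 : ℝ) * p.2))]
  · simp only [one_div_mul_one_div]
    refine Finset.sum_le_sum_of_subset_of_nonneg ?_ fun _ _ _ => by positivity
    intro p hp
    obtain ⟨r, hr, rfl⟩ := Finset.mem_image.1 hp
    rw [Finset.mem_product, Finset.mem_Icc, Finset.mem_Icc]
    exact ⟨ha r hr, r.pos, (den_le_of_mem_properFractions D r hr).2⟩
  · intro r hr s hs h
    rw [Prod.mk.injEq] at h
    exact hinj r hr s hs h.2 h.1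

theorem sum_norm_sq_wHat_le (D H : ℕ) (hH : 0 < H) :
    ∑ r ∈ properFractions D, ‖wHat H r‖ ^ 2 / (r.den : ℝ) ^ 2 ≤ 10 * H * harmonicReal D ^ 2 := by
  have hnum : ∀ r ∈ properFractions D, 1 ≤ r.num.toNat ∧ r.num.toNat < r.den ∧
      (r : ℝ) = (r.num.toNat : ℝ) / r.den := by
    intro r hr
    obtain ⟨⟨h0, h1⟩, _⟩ := den_le_of_mem_properFractions D r hr
    have h2 : 0 < r.num := Rat.num_pos.2 h0
    have h3 : r.num < r.den := Rat.num_lt_denom_iff.2 h1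
    refine ⟨by omega, by omega, ?_⟩
    have h4 : ((r.num.toNat : ℤ) : ℝ) = r.num := by rw [Int.toNat_of_nonneg h2.le]
    rw [← Int.cast_natCast r.num.toNat, h4]
    exact Rat.cast_def r
  have hinj : ∀ r ∈ properFractions D, ∀ s ∈ properFractions D, r.den = s.den →
      r.num.toNat = s.num.toNat → r = s := by
    intro r hr s hs h1 h2
    have h3 := (hnum r hr).2.2
    rw [h1, h2, ← (hnum s hs).2.2] at h3
    exact_mod_cast h3
  have hA := sum_properFractions_le D (fun r => r.num.toNat)
    (fun r hr => by
      have := (den_le_of_mem_properFractions D r hr).2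
      have := hnum r hr
      omega) hinj
  have hB := sum_properFractions_le D (fun r => r.den - r.num.toNat)
    (fun r hr => by
      have := (den_le_of_mem_properFractions D r hr).2
      have := hnum r hr
      omega)
    (fun r hr s hs h1 h2 => hinj r hr s hs h1 (by
      have := hnum r hr
      have := hnum s hs
      omega))
  calc ∑ r ∈ properFractions D, ‖wHat H r‖ ^ 2 / (r.den : ℝ) ^ 2
      ≤ ∑ r ∈ properFractions D, 5 * H * (1 / ((r.num.toNat : ℝ) * r.den) +
          1 / (((r.den - r.num.toNat : ℕ) : ℝ) * r.den)) := by
        refine Finset.sum_le_sum fun r hr => ?_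
        obtain ⟨h1, h2, h3⟩ := hnum r hr
        obtain ⟨⟨h4, h5⟩, _⟩ := den_le_of_mem_properFractions D r hr
        have hden : (0 : ℝ) < r.den := by exact_mod_cast r.pos
        have hn1 : (0 : ℝ) < r.num.toNat := by exact_mod_cast h1
        have hn2 : (r.num.toNat : ℝ) < r.den := by exact_mod_cast h2
        have hn3 : (0 : ℝ) < (r.den : ℝ) - r.num.toNat := by linarith
        have h6 := norm_sq_wHat_le H hH r (by exact_mod_cast h4) (by exact_mod_cast h5)
        rw [Nat.cast_sub h2.le]
        calc ‖wHat H r‖ ^ 2 / (r.den : ℝ) ^ 2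
            ≤ 5 * H * (1 / (r : ℝ) + 1 / (1 - (r : ℝ))) / (r.den : ℝ) ^ 2 := by gcongr
          _ = _ := by
            rw [h3, one_sub_div hden.ne']
            field_simp
    _ ≤ _ := by
        rw [← Finset.mul_sum, Finset.sum_add_distrib]
        have := add_le_add hA hB
        have hH0 : (0 : ℝ) ≤ 5 * H := by positivity
        have := mul_le_mul_of_nonneg_left this hH0
        linarith

/-- Mean square of the part of the sum over `n = d * m` with `d ≤ D`, by the large sieve. -/
theorem sum_sq_smallDivisor_le (g : ℕ → ℝ) (B : ℝ) (D N H R : ℕ) (hH : 0 < H) (hD : 0 < D)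
    (hg : ∀ d ∈ Finset.Icc 1 D, |g d| ≤ B) (hB : 0 ≤ B) (hHN : H ≤ N) (hR : 2 * N + H ≤ R) :
    ∑ x ∈ Finset.Ioc N (2 * N), (∑ d ∈ Finset.Icc 1 D, g d *
        ∑ m ∈ Finset.Icc 1 R, wH' H (((d * m : ℕ) : ℤ) - x)) ^ 2 ≤
      10 * B ^ 2 * H * harmonicReal D ^ 4 * (N + (D ^ 2 : ℕ) * harmonicReal (D ^ 2)) := by
  set T := (Finset.Icc 1 D).sigma fun d => Finset.Ico 1 d with hT
  set c : ℚ → ℂ := fun r => (∑ p ∈ T with (p.2 : ℚ) / p.1 = r, (g p.1 : ℂ) / p.1) * wHat H r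
    with hc
  have hexp : ∀ x ∈ Finset.Ioc N (2 * N), (∑ d ∈ Finset.Icc 1 D, g d *
        ∑ m ∈ Finset.Icc 1 R, wH' H (((d * m : ℕ) : ℤ) - x)) ^ 2 =
      ‖∑ r ∈ properFractions D, c r * eC (x * (r : ℝ))‖ ^ 2 := by
    intro x hx
    rw [Finset.mem_Ioc] at hx
    rw [← sq_abs, ← Real.norm_eq_abs, ← Complex.norm_real]
    congr 2
    rw [Complex.ofReal_sum]
    have h1 : ∀ d ∈ Finset.Icc 1 D, ((g d * ∑ m ∈ Finset.Icc 1 R,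
        wH' H (((d * m : ℕ) : ℤ) - x) : ℝ) : ℂ) = ∑ j ∈ Finset.Ico 1 d,
          (g d : ℂ) / d * wHat H (((j : ℚ) / d : ℚ) : ℝ) * eC (x * (((j : ℚ) / d : ℚ) : ℝ)) := by
      intro d hd
      rw [Finset.mem_Icc] at hd
      rw [Complex.ofReal_mul, sum_wH'_mul_sub_eq_wHat H d x R hH hd.1 (by omega) (by omega),
        Finset.mul_sum]
      refine Finset.sum_congr rfl fun j _ => ?_
      push_cast
      ring
    rw [Finset.sum_congr rfl h1, Finset.sum_sigma', ← hT,
      ← Finset.sum_fiberwise_of_maps_to (t := properFractions D)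
        (g := fun p : (_ : ℕ) × ℕ => (p.2 : ℚ) / p.1)
        (fun p hp => Finset.mem_image_of_mem _ hp)]
    refine Finset.sum_congr rfl fun r _ => ?_
    rw [hc]
    simp only [Finset.sum_mul]
    refine Finset.sum_congr rfl fun p hp => ?_
    rw [(Finset.mem_filter.1 hp).2]
  rw [Finset.sum_congr rfl hexp]
  refine (sum_norm_sq_sum_eC_le _ D N hD (den_le_of_mem_properFractions D) c).trans ?_
  have hcr : ∀ r ∈ properFractions D,
      ‖c r‖ ^ 2 ≤ (B * harmonicReal D) ^ 2 * (‖wHat H r‖ ^ 2 / (r.den : ℝ) ^ 2) := by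
    intro r _
    have h1 : ‖∑ p ∈ T with (p.2 : ℚ) / p.1 = r, (g p.1 : ℂ) / p.1‖ ≤
        B * (harmonicReal D / r.den) := by
      refine (norm_sum_le _ _).trans (le_trans ?_
        (mul_le_mul_of_nonneg_left (sum_one_div_fiber_le D r) hB))
      rw [Finset.mul_sum]
      refine Finset.sum_le_sum fun p hp => ?_
      rw [Finset.mem_filter, hT, Finset.mem_sigma] at hp
      rw [norm_div, Complex.norm_real, Complex.norm_natCast, Real.norm_eq_abs, mul_one_div]
      gcongr
      exact hg _ hp.1.1
    calc ‖c r‖ ^ 2 ≤ (B * (harmonicReal D / r.den) * ‖wHat H r‖) ^ 2 := by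
          rw [hc, norm_mul]
          gcongr
      _ = _ := by ring
  have hs : ∑ r ∈ properFractions D, ‖c r‖ ^ 2 ≤
      (B * harmonicReal D) ^ 2 * (10 * H * harmonicReal D ^ 2) := by
    refine (Finset.sum_le_sum hcr).trans ?_
    rw [← Finset.mul_sum]
    exact mul_le_mul_of_nonneg_left (sum_norm_sq_wHat_le D H hH) (by positivity)
  have hh := harmonicReal_nonneg (D ^ 2)
  calc _ ≤ (N + (D ^ 2 : ℕ) * harmonicReal (D ^ 2)) *
        ((B * harmonicReal D) ^ 2 * (10 * H * harmonicReal D ^ 2)) :=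
        mul_le_mul_of_nonneg_left hs (by positivity)
    _ = _ := by ring

theorem sum_wH'_mul_sum_divisors (g : ℕ → ℝ) (H x R : ℕ) (hH : 0 < H) (hR : x + H ≤ R) :
    ∑ n ∈ Finset.Icc 1 (x + H), wH' H ((n : ℤ) - x) * ∑ d ∈ n.divisors, g d =
      ∑ d ∈ Finset.Icc 1 R, ∑ m ∈ Finset.Icc 1 R, g d * wH' H (((d * m : ℕ) : ℤ) - x) := by
  have h1 : ∀ n ∈ Finset.Icc 1 (x + H), wH' H ((n : ℤ) - x) * ∑ d ∈ n.divisors, g d =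
      ∑ d ∈ Finset.Icc 1 R, ∑ m ∈ Finset.Icc 1 R,
        if n = d * m then g d * wH' H (((d * m : ℕ) : ℤ) - x) else 0 := by
    intro n hn
    rw [Finset.mem_Icc] at hn
    rw [← Finset.sum_product', ← Finset.sum_filter]
    have h2 : ((Finset.Icc 1 R) ×ˢ (Finset.Icc 1 R)).filter (fun p : ℕ × ℕ => n = p.1 * p.2) =
        n.divisorsAntidiagonal := by
      ext ⟨d, m⟩
      rw [Finset.mem_filter, Finset.mem_product, Finset.mem_Icc, Finset.mem_Icc,
        Nat.mem_divisorsAntidiagonal]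
      simp only
      constructor
      · rintro ⟨_, h⟩
        exact ⟨h.symm, by omega⟩
      · rintro ⟨h, _⟩
        have hd : d ∣ n := ⟨m, h.symm⟩
        have hm : m ∣ n := ⟨d, by rw [← h, mul_comm]⟩
        have hd' := Nat.le_of_dvd (by omega) hd
        have hm' := Nat.le_of_dvd (by omega) hm
        have hd0 := Nat.pos_of_dvd_of_pos hd (by omega)
        have hm0 := Nat.pos_of_dvd_of_pos hm (by omega)
        exact ⟨⟨⟨hd0, by omega⟩, hm0, by omega⟩, h.symm⟩
    rw [h2, Finset.mul_sum,
      Nat.sum_divisorsAntidiagonal fun d m => g d * wH' H (((d * m : ℕ) : ℤ) - x)]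
    refine Finset.sum_congr rfl fun d hd => ?_
    rw [Nat.mul_div_cancel' (Nat.dvd_of_mem_divisors hd), mul_comm]
  rw [Finset.sum_congr rfl h1, Finset.sum_comm]
  refine Finset.sum_congr rfl fun d hd => ?_
  rw [Finset.sum_comm]
  refine Finset.sum_congr rfl fun m hm => ?_
  rw [Finset.sum_ite_eq']
  rw [Finset.mem_Icc] at hd hm
  split_ifs with h
  · rfl
  · have h3 : 0 < d * m := Nat.mul_pos hd.1 hm.1
    rw [Finset.mem_Icc] at h
    rw [wH'_eq_zero H hH _ (by rw [abs_of_pos] <;> omega), mul_zero]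

theorem sq_sum_Icc_le (S : ℕ → ℝ) (Y : ℕ) :
    (∑ m ∈ Finset.Icc 1 Y, S m) ^ 2 ≤
      harmonicReal Y * ∑ m ∈ Finset.Icc 1 Y, (m : ℝ) * S m ^ 2 := by
  refine Finset.sum_sq_le_sum_mul_sum_of_sq_le_mul _ (fun _ _ => by positivity)
    (fun _ _ => by positivity) fun m hm => ?_
  have hm0 : (m : ℝ) ≠ 0 := by
    have := (Finset.mem_Icc.1 hm).1
    exact_mod_cast (show m ≠ 0 by omega)
  exact le_of_eq (by field_simp)

/-- The part `d > D` of the sum over multiples of `m`. -/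
noncomputable def largeDivisorSum (g : ℕ → ℝ) (D R H m x : ℕ) : ℝ :=
  ∑ d ∈ Finset.Ioc D R, g d * wH' H (((d * m : ℕ) : ℤ) - x)

theorem abs_largeDivisorSum_le (g : ℕ → ℝ) (B : ℝ) (D R H m x : ℕ) (hm : 0 < m) (hmH : m ≤ H)
    (hB : 0 ≤ B) (hg : ∀ d ∈ Finset.Icc 1 R, |g d| ≤ B) :
    |largeDivisorSum g D R H m x| ≤ B * (3 * H / m) := by
  have hmR : (0 : ℝ) < m := by exact_mod_cast hm
  have hmH' : (m : ℝ) ≤ H := by exact_mod_cast hmH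
  have h1 : largeDivisorSum g D R H m x =
      ∑ d ∈ (Finset.Ioc D R).filter fun d : ℕ => |(d : ℝ) - (x : ℝ) / m| ≤ (H : ℝ) / m,
        g d * wH' H (((d * m : ℕ) : ℤ) - x) := by
    symm
    refine Finset.sum_subset (Finset.filter_subset _ _) fun d hd hnd => ?_
    rw [Finset.mem_filter, not_and, not_le] at hnd
    have h2 := hnd hd
    rw [div_lt_iff₀ hmR, ← abs_of_pos hmR, ← abs_mul, abs_of_pos hmR, sub_mul,
      div_mul_cancel₀ _ hmR.ne'] at h2
    rw [wH'_eq_zero H (by omega) _ (by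
      push_cast
      exact_mod_cast h2), mul_zero]
  rw [h1]
  refine (Finset.abs_sum_le_sum_abs _ _).trans ?_
  refine (Finset.sum_le_card_nsmul _ _ B fun d hd => ?_).trans ?_
  · rw [Finset.mem_filter, Finset.mem_Ioc] at hd
    rw [abs_mul]
    have h3 := hg d (Finset.mem_Icc.2 ⟨by omega, by omega⟩)
    have h4 := abs_wH'_le H (by omega) (((d * m : ℕ) : ℤ) - x)
    nlinarith [abs_nonneg (g d)]
  · rw [nsmul_eq_mul, mul_comm]
    refine mul_le_mul_of_nonneg_left ?_ hB
    refine (card_filter_abs_sub_le _ _ _ (by positivity)).trans ?_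
    have h5 : 1 ≤ (H : ℝ) / m := by rwa [one_le_div hmR]
    have h6 : 3 * (H : ℝ) / m = 3 * ((H : ℝ) / m) := by ring
    linarith

theorem largeDivisorSum_eq_dilatedSum (g : ℕ → ℝ) (D R H m x : ℕ) (hH : 0 < H)
    (h : m * D + H < x) : largeDivisorSum g D R H m x = dilatedSum g R H m x := by
  rw [dilatedSum, largeDivisorSum]
  simp only [mul_comm (wH' _ _)]
  refine Finset.sum_subset (fun d hd => ?_) fun d hd hnd => ?_
  · rw [Finset.mem_Ioc] at hd
    exact Finset.mem_Icc.2 ⟨by omega, hd.2⟩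
  · rw [Finset.mem_Icc] at hd
    rw [Finset.mem_Ioc] at hnd
    have h1 : d * m ≤ m * D := by
      rw [mul_comm]
      exact Nat.mul_le_mul_left _ (by omega)
    rw [wH'_eq_zero H hH _ (by rw [abs_of_neg] <;> omega), mul_zero]

theorem largeDivisorSum_eq_zero (g : ℕ → ℝ) (D R H m x : ℕ) (hH : 0 < H)
    (h : x + H < m * (D + 1)) : largeDivisorSum g D R H m x = 0 := by
  refine Finset.sum_eq_zero fun d hd => ?_
  rw [Finset.mem_Ioc] at hd
  have h1 : m * (D + 1) ≤ d * m := by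
    rw [mul_comm d]
    exact Nat.mul_le_mul_left _ (by omega)
  rw [wH'_eq_zero H hH _ (by rw [abs_of_pos] <;> omega), mul_zero]

theorem sum_sq_largeDivisorSum_le (g : ℕ → ℝ) (B : ℝ) (D N R H m : ℕ) (hm : 0 < m) (hmH : m ≤ H)
    (hB : 0 ≤ B) (hg : ∀ d ∈ Finset.Icc 1 R, |g d| ≤ B) :
    ∑ x ∈ Finset.Ioc N (2 * N), largeDivisorSum g D R H m x ^ 2 ≤
      ∑ x ∈ Finset.Ioc N (2 * N), dilatedSum g R H m x ^ 2 +
        5 * H * (B * (3 * H / m)) ^ 2 := by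
  have hH : 0 < H := by omega
  have hmH' : (m : ℝ) ≤ H := by exact_mod_cast hmH
  have hHR : (1 : ℝ) ≤ H := by exact_mod_cast hH
  have hpt : ∀ x ∈ Finset.Ioc N (2 * N), largeDivisorSum g D R H m x ^ 2 ≤
      dilatedSum g R H m x ^ 2 +
        if |(x : ℝ) - (m * D : ℕ)| ≤ (H : ℝ) + m then (B * (3 * H / m)) ^ 2 else 0 := by
    intro x _
    by_cases hc : |(x : ℝ) - (m * D : ℕ)| ≤ (H : ℝ) + m
    · rw [if_pos hc]
      have h1 := abs_largeDivisorSum_le g B D R H m x hm hmH hB hg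
      have h2 : largeDivisorSum g D R H m x ^ 2 ≤ (B * (3 * H / m)) ^ 2 :=
        sq_le_sq' (abs_le.1 h1).1 (abs_le.1 h1).2
      nlinarith [sq_nonneg (dilatedSum g R H m x)]
    · rw [if_neg hc, add_zero]
      rw [not_le, lt_abs] at hc
      rcases hc with hc | hc
      · have h1 : (m * D + H + m : ℕ) < (x : ℝ) := by
          push_cast at hc ⊢
          linarith
        have h2 : m * D + H + m < x := by exact_mod_cast h1
        rw [largeDivisorSum_eq_dilatedSum g D R H m x hH (by omega)]
      · have h1 : ((x + H : ℕ) : ℝ) < ((m * (D + 1) : ℕ) : ℝ) := by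
          push_cast at hc ⊢
          linarith [(Nat.cast_nonneg m : (0 : ℝ) ≤ m)]
        rw [largeDivisorSum_eq_zero g D R H m x hH (by exact_mod_cast h1), zero_pow two_ne_zero]
        positivity
  refine (Finset.sum_le_sum hpt).trans ?_
  rw [Finset.sum_add_distrib, ← Finset.sum_filter, Finset.sum_const, nsmul_eq_mul]
  gcongr
  refine (card_filter_abs_sub_le _ _ _ (by positivity)).trans ?_
  linarith

/-- Combination of the small and the large divisors, with explicit parameters. -/
theorem Jw'_sum_divisors_le (g : ℕ → ℝ) (B V G : ℝ) (D Y N H : ℕ) (hG : 0 < G)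
    (hH : 0 < H) (hHN : H ≤ N) (hD : 0 < D) (hDN : D ≤ N) (hYH : Y ≤ H) (hV : 0 ≤ V)
    (hDY : 3 * N < (Y + 1) * D) (hg : ∀ d ∈ Finset.Icc 1 (6 * N), |g d| ≤ B)
    (hdil : ∀ m ∈ Finset.Icc 1 Y, ∑ x ∈ Finset.Ioc N (2 * N), dilatedSum g (6 * N) H m x ^ 2 ≤
      V * N * ((H : ℝ) / m) ^ (2 - G)) :
    Jw' (fun n => ∑ d ∈ n.divisors, g d) N H ≤
      2 * (10 * B ^ 2 * H * harmonicReal D ^ 4 * (N + (D ^ 2 : ℕ) * harmonicReal (D ^ 2))) +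
      2 * (harmonicReal Y * ((V * N * (H : ℝ) ^ (2 - G) * (Y : ℝ) ^ G + 45 * B ^ 2 * (H : ℝ) ^ 3)
        * harmonicReal Y)) := by
  have hN : 0 < N := by omega
  have hB : 0 ≤ B := (abs_nonneg _).trans (hg 1 (Finset.mem_Icc.2 ⟨le_rfl, by omega⟩))
  have hHR : (0 : ℝ) < H := by exact_mod_cast hH
  have hsplit : ∀ x ∈ Finset.Ioc N (2 * N),
      (∑ n ∈ Finset.Icc 1 (x + H), wH' H ((n : ℤ) - (x : ℤ)) * ∑ d ∈ n.divisors, g d) ^ 2 ≤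
      2 * (∑ d ∈ Finset.Icc 1 D, g d *
        ∑ m ∈ Finset.Icc 1 (6 * N), wH' H (((d * m : ℕ) : ℤ) - x)) ^ 2 +
      2 * (harmonicReal Y *
        ∑ m ∈ Finset.Icc 1 Y, (m : ℝ) * largeDivisorSum g D (6 * N) H m x ^ 2) := by
    intro x hx
    rw [Finset.mem_Ioc] at hx
    rw [sum_wH'_mul_sum_divisors g H x (6 * N) hH (by omega)]
    have h1 : Finset.Icc 1 (6 * N) = Finset.Icc 1 D ∪ Finset.Ioc D (6 * N) := by
      ext d
      simp only [Finset.mem_Icc, Finset.mem_union, Finset.mem_Ioc]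
      omega
    have h2 : ∑ d ∈ Finset.Icc 1 (6 * N), ∑ m ∈ Finset.Icc 1 (6 * N),
        g d * wH' H (((d * m : ℕ) : ℤ) - x) =
        ∑ d ∈ Finset.Icc 1 D, g d *
          ∑ m ∈ Finset.Icc 1 (6 * N), wH' H (((d * m : ℕ) : ℤ) - x) +
        ∑ m ∈ Finset.Icc 1 (6 * N), largeDivisorSum g D (6 * N) H m x := by
      simp only [largeDivisorSum, Finset.mul_sum]
      rw [Finset.sum_comm (s := Finset.Icc 1 (6 * N)) (t := Finset.Ioc D (6 * N)),
        ← Finset.sum_union, ← h1]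
      rw [Finset.disjoint_left]
      intro d hd hd'
      rw [Finset.mem_Icc] at hd
      rw [Finset.mem_Ioc] at hd'
      omega
    have h3 : ∑ m ∈ Finset.Icc 1 (6 * N), largeDivisorSum g D (6 * N) H m x =
        ∑ m ∈ Finset.Icc 1 Y, largeDivisorSum g D (6 * N) H m x := by
      symm
      refine Finset.sum_subset (Finset.Icc_subset_Icc le_rfl (by omega)) fun m hm hnm => ?_
      rw [Finset.mem_Icc] at hm hnm
      refine largeDivisorSum_eq_zero g D (6 * N) H m x hH ?_
      have h4 : (Y + 1) * D ≤ m * (D + 1) := Nat.mul_le_mul (by omega) (by omega)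
      omega
    rw [h2, h3]
    have h4 := sq_sum_Icc_le (fun m => largeDivisorSum g D (6 * N) H m x) Y
    refine (add_sq_le).trans ?_
    linarith
  have hsmall := sum_sq_smallDivisor_le g B D N H (6 * N) hH hD
    (fun d hd => hg d (by rw [Finset.mem_Icc] at hd ⊢; omega)) hB hHN (by omega)
  have hlarge : ∑ x ∈ Finset.Ioc N (2 * N), ∑ m ∈ Finset.Icc 1 Y,
      (m : ℝ) * largeDivisorSum g D (6 * N) H m x ^ 2 ≤
      (V * N * (H : ℝ) ^ (2 - G) * (Y : ℝ) ^ G + 45 * B ^ 2 * (H : ℝ) ^ 3) * harmonicReal Y := by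
    rw [Finset.sum_comm, harmonicReal, Finset.mul_sum]
    refine Finset.sum_le_sum fun m hm => ?_
    have hm' := Finset.mem_Icc.1 hm
    have hmR : (0 : ℝ) < m := by exact_mod_cast hm'.1
    have hmY : (m : ℝ) ≤ Y := by exact_mod_cast hm'.2
    rw [← Finset.mul_sum]
    have h1 := (sum_sq_largeDivisorSum_le g B D N (6 * N) H m hm'.1 (by omega) hB
      hg).trans (add_le_add_left (hdil m hm) _)
    calc (m : ℝ) * ∑ x ∈ Finset.Ioc N (2 * N), largeDivisorSum g D (6 * N) H m x ^ 2
        ≤ m * (V * N * ((H : ℝ) / m) ^ (2 - G) + 5 * H * (B * (3 * H / m)) ^ 2) := by gcongr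
      _ = (V * N * (H : ℝ) ^ (2 - G) * (m : ℝ) ^ G + 45 * B ^ 2 * (H : ℝ) ^ 3) * (1 / m) := by
        have h2 : (m : ℝ) ^ (2 - G) = m ^ 2 / (m : ℝ) ^ G := by
          rw [Real.rpow_sub hmR]
          norm_cast
        have h3 : (0 : ℝ) < (m : ℝ) ^ G := by positivity
        rw [Real.div_rpow hHR.le hmR.le, h2]
        field_simp
        ring
      _ ≤ _ := by gcongr
  rw [Jw']
  refine (Finset.sum_le_sum hsplit).trans ?_
  rw [Finset.sum_add_distrib, ← Finset.mul_sum, ← Finset.mul_sum, ← Finset.mul_sum]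
  have := mul_le_mul_of_nonneg_left hlarge (harmonicReal_nonneg Y)
  linarith

theorem exists_cutoff_exponent (ϑ G : ℝ) (hϑ1 : 1 / 3 < ϑ) (hϑ2 : ϑ < 1) (hG1 : 0 < G)
    (hG2 : G < 1) : ∃ δ : ℝ, 0 < δ ∧ δ < ϑ ∧ 1 - 2 * δ < ϑ ∧
      (3 * ϑ - 1) / ((1 - G) * ϑ + G + 1) < (ϑ - δ) / (1 - δ) := by
  have h0 : (1 - ϑ) / 2 < (1 - ϑ + G * ϑ) / (2 + G) := by
    rw [div_lt_div_iff₀ (by norm_num) (by linarith)]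
    nlinarith
  obtain ⟨δ, h1, h2⟩ := exists_between h0
  rw [lt_div_iff₀ (by linarith)] at h2
  have h3 : δ < ϑ := by nlinarith
  refine ⟨δ, by linarith, h3, by linarith, ?_⟩
  have h4 : 0 < (1 - G) * ϑ + G + 1 := by nlinarith
  rw [div_lt_div_iff₀ h4 (by linarith)]
  nlinarith [mul_pos (sub_pos.2 hϑ2) (sub_pos.2 h2)]

theorem harmonicReal_le_rpow (ξ : ℝ) (hξ : 0 < ξ) (K N : ℕ) (hN : 0 < N) (hKN : K ≤ N ^ 2) :
    harmonicReal K ≤ (1 + 2 / ξ) * (N : ℝ) ^ ξ := by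
  have hN1 : (1 : ℝ) ≤ N := by exact_mod_cast hN
  have h1 : Real.log K ≤ 2 * Real.log N := by
    rcases Nat.eq_zero_or_pos K with rfl | hK
    · simpa using Real.log_nonneg hN1
    · have h2 : Real.log K ≤ Real.log ((N : ℝ) ^ 2) :=
        Real.log_le_log (by exact_mod_cast hK) (by exact_mod_cast hKN)
      simpa using h2
  have h3 := Real.log_le_rpow_div (Nat.cast_nonneg (α := ℝ) N) hξ
  have h4 := Real.one_le_rpow hN1 hξ.le
  have h5 := harmonicReal_le K
  calc harmonicReal K ≤ 1 + 2 * ((N : ℝ) ^ ξ / ξ) := by linarith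
    _ ≤ (N : ℝ) ^ ξ + 2 * ((N : ℝ) ^ ξ / ξ) := by linarith
    _ = _ := by ring

theorem combined_bound_le (B b κ c P S K₁ K₂ K₃ N H E M h₁ h₂ h₃ : ℝ) (hP : 1 ≤ P) (hS : 0 ≤ S)
    (hB : 0 ≤ B) (hBb : B ≤ b * P) (hκ : 0 ≤ κ) (hc : 0 ≤ c) (hN : 0 ≤ N) (hH : 0 ≤ H)
    (hE : 0 ≤ E) (hK₁ : 0 ≤ K₁) (hK₂ : 0 ≤ K₂) (hK₃ : 0 ≤ K₃) (hh₁ : 0 ≤ h₁) (hh₃ : 0 ≤ h₃)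
    (h₁P : h₁ ≤ κ * P) (h₂P : h₂ ≤ κ * P) (h₃P : h₃ ≤ κ * P) (hNE : N + E ≤ K₁ * N * H * S)
    (hM : M ≤ K₂ * H ^ 2 * S) (hHN : H ≤ K₃ * N * S) :
    2 * (10 * B ^ 2 * H * h₁ ^ 4 * (N + E * h₂)) +
      2 * (h₃ * ((c * P ^ 4 * N * M + 45 * B ^ 2 * H ^ 3) * h₃)) ≤
    (20 * b ^ 2 * κ ^ 4 * (1 + κ) * K₁ + 2 * κ ^ 2 * c * K₂ + 90 * b ^ 2 * κ ^ 2 * K₃) *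
      N * H ^ 2 * (P ^ 7 * S) := by
  have hP0 : 0 ≤ P := by linarith
  have hNE' : N + E * h₂ ≤ (1 + κ) * P * (K₁ * N * H * S) := by
    calc N + E * h₂ ≤ N * ((1 + κ) * P) + E * ((1 + κ) * P) := by
          refine add_le_add (le_mul_of_one_le_right hN ?_) (mul_le_mul_of_nonneg_left ?_ hE)
          · nlinarith
          · linarith
      _ = (1 + κ) * P * (N + E) := by ring
      _ ≤ _ := by gcongr
  have e1 : 10 * B ^ 2 * H * h₁ ^ 4 * (N + E * h₂) ≤
      10 * (b * P) ^ 2 * H * (κ * P) ^ 4 * ((1 + κ) * P * (K₁ * N * H * S)) := by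
    refine mul_le_mul_of_nonneg (by gcongr) hNE' (by positivity) (by positivity)
  have e2 : h₃ * (c * P ^ 4 * N * M * h₃) ≤
      (κ * P) * (c * P ^ 4 * N * (K₂ * H ^ 2 * S) * (κ * P)) := by
    calc h₃ * (c * P ^ 4 * N * M * h₃) ≤ h₃ * (c * P ^ 4 * N * (K₂ * H ^ 2 * S) * h₃) := by gcongr
      _ ≤ _ := by gcongr
  have e3 : h₃ * (45 * B ^ 2 * (H ^ 2 * H) * h₃) ≤
      (κ * P) * (45 * (b * P) ^ 2 * (H ^ 2 * (K₃ * N * S)) * (κ * P)) := by gcongr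
  have p6 : P ^ 6 ≤ P ^ 7 := pow_le_pow_right₀ hP (by norm_num)
  have p4 : P ^ 4 ≤ P ^ 7 := pow_le_pow_right₀ hP (by norm_num)
  have e4 : 2 * κ ^ 2 * c * K₂ * N * H ^ 2 * (P ^ 6 * S) ≤
      2 * κ ^ 2 * c * K₂ * N * H ^ 2 * (P ^ 7 * S) := by gcongr
  have e5 : 90 * b ^ 2 * κ ^ 2 * K₃ * N * H ^ 2 * (P ^ 4 * S) ≤
      90 * b ^ 2 * κ ^ 2 * K₃ * N * H ^ 2 * (P ^ 7 * S) := by gcongr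
  linarith [e1, e2, e3, e4, e5]

theorem dilation_range_of_le (δ ϑ θ₁ c₁ c₂ : ℝ) (N H m : ℕ) (hδϑ : δ < ϑ)
    (hϑ : ϑ < 1) (hθ₁ : θ₁ = (ϑ - δ) / (1 - δ)) (hc₁ : 0 < c₁) (hN : 0 < N) (hm : 0 < m)
    (hmδ : (m : ℝ) ≤ 6 * (N : ℝ) ^ δ) (h₁ : c₁ * (N : ℝ) ^ ϑ ≤ H) (h₂ : (H : ℝ) ≤ c₂ * (N : ℝ) ^ ϑ) :
    (N : ℝ) ^ (1 - δ) / 6 ≤ (N : ℝ) / m ∧ c₁ / 6 * ((N : ℝ) / m) ^ θ₁ ≤ (H : ℝ) / m ∧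
      (H : ℝ) / m ≤ c₂ * ((N : ℝ) / m) ^ ϑ := by
  have hNR : (0 : ℝ) < N := by exact_mod_cast hN
  have hmR : (0 : ℝ) < m := by exact_mod_cast hm
  have hm1 : (1 : ℝ) ≤ m := by exact_mod_cast hm
  have hN1 : (1 : ℝ) ≤ N := by exact_mod_cast hN
  have hδ1 : 0 < 1 - δ := by linarith
  have e1 : 1 - θ₁ = (1 - ϑ) / (1 - δ) := by
    rw [hθ₁]
    field_simp
    ring
  have hθ0 : 0 ≤ 1 - θ₁ := by
    rw [e1]
    exact div_nonneg (by linarith) hδ1.le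
  have hθ1 : 1 - θ₁ ≤ 1 := by
    rw [e1, div_le_one hδ1]
    linarith
  have e2 : δ * (1 - θ₁) + θ₁ = ϑ := by
    rw [hθ₁]
    field_simp
    ring
  refine ⟨?_, ?_, ?_⟩
  · rw [div_le_div_iff₀ (by norm_num) hmR]
    calc (N : ℝ) ^ (1 - δ) * m ≤ (N : ℝ) ^ (1 - δ) * (6 * (N : ℝ) ^ δ) := by gcongr
      _ = (N : ℝ) ^ (1 - δ) * (N : ℝ) ^ δ * 6 := by ring
      _ = N * 6 := by rw [← Real.rpow_add hNR]; simp
  · have h3 : (m : ℝ) ^ (1 - θ₁) ≤ 6 * (N : ℝ) ^ (δ * (1 - θ₁)) := by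
      calc (m : ℝ) ^ (1 - θ₁) ≤ (6 * (N : ℝ) ^ δ) ^ (1 - θ₁) := by gcongr
        _ = 6 ^ (1 - θ₁) * (N : ℝ) ^ (δ * (1 - θ₁)) := by
          rw [Real.mul_rpow (by norm_num) (by positivity), ← Real.rpow_mul hNR.le]
        _ ≤ 6 ^ (1 : ℝ) * (N : ℝ) ^ (δ * (1 - θ₁)) := by
          gcongr
          norm_num
        _ = _ := by norm_num
    rw [le_div_iff₀ hmR, Real.div_rpow hNR.le hmR.le]
    have e3 : (m : ℝ) = (m : ℝ) ^ (1 - θ₁) * (m : ℝ) ^ θ₁ := by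
      rw [← Real.rpow_add hmR]
      simp
    have h4 : (0 : ℝ) < (m : ℝ) ^ θ₁ := by positivity
    calc c₁ / 6 * ((N : ℝ) ^ θ₁ / (m : ℝ) ^ θ₁) * m
        = c₁ / 6 * ((N : ℝ) ^ θ₁ / (m : ℝ) ^ θ₁) * ((m : ℝ) ^ (1 - θ₁) * (m : ℝ) ^ θ₁) := by
          rw [← e3]
      _ = c₁ / 6 * (N : ℝ) ^ θ₁ * (m : ℝ) ^ (1 - θ₁) := by
          field_simp
      _ ≤ c₁ / 6 * (N : ℝ) ^ θ₁ * (6 * (N : ℝ) ^ (δ * (1 - θ₁))) := by gcongr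
      _ = c₁ * ((N : ℝ) ^ (δ * (1 - θ₁)) * (N : ℝ) ^ θ₁) := by ring
      _ = c₁ * (N : ℝ) ^ ϑ := by rw [← Real.rpow_add hNR, e2]
      _ ≤ H := h₁
  · have hc₂ : 0 ≤ c₂ := by
      by_contra hc
      have : c₂ * (N : ℝ) ^ ϑ < 0 := mul_neg_of_neg_of_pos (not_le.1 hc) (by positivity)
      linarith [(Nat.cast_nonneg H : (0 : ℝ) ≤ H)]
    rw [Real.div_rpow hNR.le hmR.le, ← mul_div_assoc]
    have h5 : (m : ℝ) ^ ϑ ≤ m := by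
      simpa using Real.rpow_le_rpow_of_exponent_le hm1 hϑ.le
    exact div_le_div₀ (by positivity) h₂ (by positivity) h5

theorem parameter_savings (δ ϑ G σ c₁ c₂ N H D Y : ℝ) (hG : 0 < G) (hc₁ : 0 < c₁)
    (hN : 1 ≤ N) (hD0 : 0 ≤ D) (hY0 : 0 ≤ Y) (hD : D ≤ N ^ (1 - δ)) (hY : Y ≤ 6 * N ^ δ)
    (h₁ : c₁ * N ^ ϑ ≤ H) (h₂ : H ≤ c₂ * N ^ ϑ)
    (hσ1 : σ ≤ ϑ) (hσ2 : σ ≤ 2 * δ - 1 + ϑ) (hσ3 : σ ≤ G * (ϑ - δ)) (hσ4 : σ ≤ 1 - ϑ) :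
    N + D ^ 2 ≤ 2 / c₁ * N * H * N ^ (-σ) ∧
      H ^ (2 - G) * Y ^ G ≤ (6 / c₁) ^ G * H ^ 2 * N ^ (-σ) ∧ H ≤ c₂ * N * N ^ (-σ) := by
  have hN0 : 0 < N := by linarith
  have hH : 0 < H := lt_of_lt_of_le (by positivity) h₁
  have hc₂ : 0 < c₂ := by
    by_contra hc
    have : c₂ * N ^ ϑ ≤ 0 := mul_nonpos_of_nonpos_of_nonneg (not_lt.1 hc) (by positivity)
    linarith
  refine ⟨?_, ?_, ?_⟩
  · have h3 : N ^ (ϑ - σ) ≤ H / c₁ * N ^ (-σ) := by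
      rw [sub_eq_add_neg, Real.rpow_add hN0]
      gcongr
      rw [le_div_iff₀ hc₁]
      linarith
    have h4 : 1 ≤ N ^ (ϑ - σ) := Real.one_le_rpow hN (by linarith)
    have h5 : D ^ 2 ≤ N * N ^ (ϑ - σ) := by
      calc D ^ 2 ≤ (N ^ (1 - δ)) ^ 2 := by gcongr
        _ = N ^ ((1 - δ) * 2) := by rw [Real.rpow_mul hN0.le]; norm_cast
        _ ≤ N ^ (1 + (ϑ - σ)) := Real.rpow_le_rpow_of_exponent_le hN (by linarith)
        _ = _ := by rw [Real.rpow_add hN0, Real.rpow_one]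
    calc N + D ^ 2 ≤ 2 * (N * N ^ (ϑ - σ)) := by nlinarith
      _ ≤ 2 * (N * (H / c₁ * N ^ (-σ))) := by gcongr
      _ = _ := by ring
  · have h3 : Y / H ≤ 6 / c₁ * N ^ (-(ϑ - δ)) := by
      rw [div_le_iff₀ hH]
      calc Y ≤ 6 * N ^ δ := hY
        _ = 6 / c₁ * N ^ (-(ϑ - δ)) * (c₁ * N ^ ϑ) := by
          have : N ^ δ = N ^ (-(ϑ - δ)) * N ^ ϑ := by
            rw [← Real.rpow_add hN0]
            congr 1
            ring
          rw [this]
          field_simp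
        _ ≤ _ := by gcongr
    have h4 : H ^ (2 - G) * Y ^ G = H ^ 2 * (Y / H) ^ G := by
      rw [Real.rpow_sub hH, Real.div_rpow hY0 hH.le]
      norm_cast
      ring
    rw [h4]
    calc H ^ 2 * (Y / H) ^ G ≤ H ^ 2 * (6 / c₁ * N ^ (-(ϑ - δ))) ^ G := by gcongr
      _ = H ^ 2 * ((6 / c₁) ^ G * N ^ (-(ϑ - δ) * G)) := by
        rw [Real.mul_rpow (by positivity) (by positivity), ← Real.rpow_mul hN0.le]
      _ ≤ H ^ 2 * ((6 / c₁) ^ G * N ^ (-σ)) := by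
        gcongr
        linarith
      _ = _ := by ring
  · calc H ≤ c₂ * N ^ ϑ := h₂
      _ ≤ c₂ * N ^ (1 + -σ) := by
        gcongr
        linarith
      _ = _ := by rw [Real.rpow_add hN0, Real.rpow_one]; ring

theorem Jw'_sum_divisors_le_of_large (g : ℕ → ℝ) (hg : EssBdd g) (ϑ G δ σ c₁ c₂ : ℝ)
    (hϑ2 : ϑ < 1) (hG1 : 0 < G) (hG2 : G < 1) (hδ : 0 < δ) (hδϑ : δ < ϑ)
    (hσ : 0 < σ) (hσ1 : σ ≤ ϑ) (hσ2 : σ ≤ 2 * δ - 1 + ϑ) (hσ3 : σ ≤ G * (ϑ - δ))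
    (hσ4 : σ ≤ 1 - ϑ) (hc₁ : 0 < c₁) (hc : c₁ < c₂)
    (hyp : ∀ θ : ℝ, (ϑ - δ) / (1 - δ) ≤ θ → θ ≤ ϑ → ∀ c₁ c₂ : ℝ, 0 < c₁ → c₁ < c₂ →
      ∃ C : ℝ, 0 < C ∧ ∀ M h : ℕ, 0 < M → 0 < h →
        c₁ * (M : ℝ) ^ θ ≤ (h : ℝ) → (h : ℝ) ≤ c₂ * (M : ℝ) ^ θ →
        Jw' g M h ≤ C * (M : ℝ) * (h : ℝ) ^ (2 - G)) :
    ∃ (K : ℝ) (N₀ : ℕ), 0 < K ∧ ∀ N H : ℕ, N₀ ≤ N → 0 < N → 0 < H →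
      c₁ * (N : ℝ) ^ ϑ ≤ (H : ℝ) → (H : ℝ) ≤ c₂ * (N : ℝ) ^ ϑ →
      Jw' (fun n => ∑ d ∈ n.divisors, g d) N H ≤ K * N * (H : ℝ) ^ 2 * (N : ℝ) ^ (-(σ / 2)) := by
  have hδ1 : 0 < 1 - δ := by linarith
  have hϑ0 : 0 < ϑ := by linarith
  have hc₂ : 0 < c₂ := hc₁.trans hc
  have hξ : 0 < σ / 14 := by positivity
  obtain ⟨Cg, hCg, hgb⟩ := hg (σ / 14) hξ
  have hθ₁ϑ : (ϑ - δ) / (1 - δ) ≤ ϑ := by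
    rw [div_le_iff₀ hδ1]
    nlinarith
  obtain ⟨C, Z₀, hC, hZ₀, hdil⟩ := sum_sq_dilatedSum_le_of_range g hg G ((ϑ - δ) / (1 - δ)) ϑ
    (σ / 14) (c₁ / 6) c₂ hG1 hG2 (div_pos (by linarith) hδ1) hθ₁ϑ hξ (by linarith) (by linarith)
    (by positivity) (by linarith) hyp
  have hlarge : ∀ (a : ℝ), 0 < a → ∀ A : ℝ, ∀ᶠ N : ℕ in Filter.atTop, A ≤ (N : ℝ) ^ a :=
    fun a ha A => ((tendsto_rpow_atTop ha).comp
      tendsto_natCast_atTop_atTop).eventually_ge_atTop A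
  obtain ⟨N₀, hN₀⟩ := Filter.eventually_atTop.1
    (((hlarge (1 - ϑ) (by linarith) c₂).and (hlarge (ϑ - δ) (by linarith) (6 / c₁))).and
      (hlarge (1 - δ) hδ1 (6 * Z₀)))
  refine ⟨20 * (6 * Cg) ^ 2 * (1 + 2 / (σ / 14)) ^ 4 * (1 + (1 + 2 / (σ / 14))) * (2 / c₁) +
    2 * (1 + 2 / (σ / 14)) ^ 2 * C * (6 / c₁) ^ G +
    90 * (6 * Cg) ^ 2 * (1 + 2 / (σ / 14)) ^ 2 * c₂, N₀, by positivity,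
    fun N H hNN hN hH h₁ h₂ => ?_⟩
  obtain ⟨⟨hN1, hN2⟩, hN3⟩ := hN₀ N hNN
  have hNR : (0 : ℝ) < N := by exact_mod_cast hN
  have hNR1 : (1 : ℝ) ≤ N := by exact_mod_cast hN
  have hHN : H ≤ N := by
    have : (H : ℝ) ≤ N := by
      calc (H : ℝ) ≤ c₂ * (N : ℝ) ^ ϑ := h₂
        _ ≤ (N : ℝ) ^ (1 - ϑ) * (N : ℝ) ^ ϑ := by gcongr
        _ = N := by rw [← Real.rpow_add hNR]; simp
    exact_mod_cast this
  set D := ⌊(N : ℝ) ^ (1 - δ)⌋₊ with hDdef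
  set Y := ⌊6 * (N : ℝ) ^ δ⌋₊ with hYdef
  have hx1 : 1 ≤ (N : ℝ) ^ (1 - δ) := Real.one_le_rpow hNR1 hδ1.le
  have hDle : (D : ℝ) ≤ (N : ℝ) ^ (1 - δ) := Nat.floor_le (by positivity)
  have hDlt : (N : ℝ) ^ (1 - δ) < D + 1 := Nat.lt_floor_add_one _
  have hD0 : 0 < D := Nat.floor_pos.2 hx1
  have hD1 : (1 : ℝ) ≤ D := by exact_mod_cast hD0
  have hDN : D ≤ N := by
    have : (D : ℝ) ≤ N := hDle.trans (by
      simpa using Real.rpow_le_rpow_of_exponent_le hNR1 (by linarith : 1 - δ ≤ 1))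
    exact_mod_cast this
  have hYle : (Y : ℝ) ≤ 6 * (N : ℝ) ^ δ := Nat.floor_le (by positivity)
  have hYlt : 6 * (N : ℝ) ^ δ < Y + 1 := Nat.lt_floor_add_one _
  have hYH : Y ≤ H := by
    have : (Y : ℝ) ≤ H := by
      calc (Y : ℝ) ≤ 6 * (N : ℝ) ^ δ := hYle
        _ = c₁ * (6 / c₁ * (N : ℝ) ^ δ) := by field_simp
        _ ≤ c₁ * ((N : ℝ) ^ (ϑ - δ) * (N : ℝ) ^ δ) := by gcongr
        _ = c₁ * (N : ℝ) ^ ϑ := by rw [← Real.rpow_add hNR]; simp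
        _ ≤ H := h₁
    exact_mod_cast this
  have hDY : 3 * N < (Y + 1) * D := by
    have : 3 * (N : ℝ) < (Y + 1) * D := by
      calc 3 * (N : ℝ) = 6 * (N : ℝ) ^ δ * ((N : ℝ) ^ (1 - δ) / 2) := by
            have : (N : ℝ) = (N : ℝ) ^ δ * (N : ℝ) ^ (1 - δ) := by
              rw [← Real.rpow_add hNR]
              simp
            linarith
        _ < (Y + 1) * D := by
            refine mul_lt_mul hYlt (by linarith) (by positivity) (by positivity)
    exact_mod_cast this
  have hgB : ∀ d ∈ Finset.Icc 1 (6 * N), |g d| ≤ 6 * Cg * (N : ℝ) ^ (σ / 14) := by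
    intro d hd
    rw [Finset.mem_Icc] at hd
    have hd6 : (d : ℝ) ≤ 6 * N := by exact_mod_cast hd.2
    calc |g d| ≤ Cg * (d : ℝ) ^ (σ / 14) := hgb d hd.1
      _ ≤ Cg * (6 * N) ^ (σ / 14) := by gcongr
      _ = Cg * (6 ^ (σ / 14) * (N : ℝ) ^ (σ / 14)) := by
        rw [Real.mul_rpow (by norm_num) hNR.le]
      _ ≤ Cg * (6 ^ (1 : ℝ) * (N : ℝ) ^ (σ / 14)) := by
        gcongr
        · norm_num
        · linarith
      _ = _ := by
        rw [Real.rpow_one]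
        ring
  have hP4 : (N : ℝ) ^ (4 * (σ / 14)) = ((N : ℝ) ^ (σ / 14)) ^ 4 := by
    rw [mul_comm, Real.rpow_mul hNR.le]
    norm_cast
  have hdil' : ∀ m ∈ Finset.Icc 1 Y, ∑ x ∈ Finset.Ioc N (2 * N), dilatedSum g (6 * N) H m x ^ 2 ≤
      C * ((N : ℝ) ^ (σ / 14)) ^ 4 * N * ((H : ℝ) / m) ^ (2 - G) := by
    intro m hm
    rw [Finset.mem_Icc] at hm
    have hmY : (m : ℝ) ≤ Y := by exact_mod_cast hm.2
    obtain ⟨r1, r2, r3⟩ := dilation_range_of_le δ ϑ _ c₁ c₂ N H m hδϑ hϑ2 rfl hc₁ hN hm.1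
      (hmY.trans hYle) h₁ h₂
    refine (hdil N H m hN hm.1 (by linarith) r2 r3).trans (le_of_eq ?_)
    rw [hP4]
    ring
  have hmain := Jw'_sum_divisors_le g (6 * Cg * (N : ℝ) ^ (σ / 14))
    (C * ((N : ℝ) ^ (σ / 14)) ^ 4) G D Y N H hG1 hH hHN hD0 hDN hYH (by positivity) hDY hgB hdil'
  obtain ⟨s1, s2, s3⟩ := parameter_savings δ ϑ G σ c₁ c₂ N H D Y hG1 hc₁ hNR1 (by positivity)
    (by positivity) hDle hYle h₁ h₂ hσ1 hσ2 hσ3 hσ4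
  have hNN2 : N ≤ N ^ 2 := Nat.le_self_pow two_ne_zero N
  have hcomb := combined_bound_le (6 * Cg * (N : ℝ) ^ (σ / 14)) (6 * Cg) (1 + 2 / (σ / 14)) C
    ((N : ℝ) ^ (σ / 14)) ((N : ℝ) ^ (-σ)) (2 / c₁) ((6 / c₁) ^ G) c₂ N H ((D ^ 2 : ℕ) : ℝ)
    ((H : ℝ) ^ (2 - G) * (Y : ℝ) ^ G) (harmonicReal D) (harmonicReal (D ^ 2)) (harmonicReal Y)
    (Real.one_le_rpow hNR1 hξ.le) (by positivity) (by positivity) le_rfl (by positivity) hC.le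
    hNR.le (by positivity) (by positivity) (by positivity) (by positivity) (by linarith)
    (harmonicReal_nonneg _) (harmonicReal_nonneg _)
    (harmonicReal_le_rpow _ hξ _ _ hN (hDN.trans hNN2))
    (harmonicReal_le_rpow _ hξ _ _ hN (Nat.pow_le_pow_left hDN 2))
    (harmonicReal_le_rpow _ hξ _ _ hN ((hYH.trans hHN).trans hNN2))
    (by push_cast; exact s1) s2 s3
  have hP7 : ((N : ℝ) ^ (σ / 14)) ^ 7 * (N : ℝ) ^ (-σ) = (N : ℝ) ^ (-(σ / 2)) := by
    rw [← Real.rpow_natCast, ← Real.rpow_mul hNR.le, ← Real.rpow_add hNR]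
    congr 1
    push_cast
    ring
  rw [hP7] at hcomb
  refine hmain.trans (le_trans (le_of_eq ?_) hcomb)
  ring

theorem stmt3 (ϑ G : ℝ)
    (hϑ1 : 1 / 3 < ϑ) (hϑ2 : ϑ < 1) (hG1 : 0 < G) (hG2 : G < 1) :
    ∃ G' : ℝ, 0 < G' ∧ ∀ g : ℕ → ℝ, EssBdd g →
      (∀ θ : ℝ, (3 * ϑ - 1) / ((1 - G) * ϑ + G + 1) < θ → θ ≤ ϑ →
        ∀ c₁ c₂ : ℝ, 0 < c₁ → c₁ < c₂ →
          ∃ C : ℝ, 0 < C ∧ ∀ M h : ℕ, 0 < M → 0 < h →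
            c₁ * (M : ℝ) ^ θ ≤ (h : ℝ) → (h : ℝ) ≤ c₂ * (M : ℝ) ^ θ →
            Jw' g M h ≤ C * (M : ℝ) * (h : ℝ) ^ (2 - G)) →
      ∀ c₁ c₂ : ℝ, 0 < c₁ → c₁ < c₂ →
        ∃ C' : ℝ, 0 < C' ∧ ∀ N H : ℕ, 0 < N → 0 < H →
          c₁ * (N : ℝ) ^ ϑ ≤ (H : ℝ) → (H : ℝ) ≤ c₂ * (N : ℝ) ^ ϑ →
          Jw' (fun n => ∑ d ∈ n.divisors, g d) N H ≤ C' * (N : ℝ) * (H : ℝ) ^ (2 - 3 * G') := by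
  obtain ⟨δ, hδ, hδϑ, hδ2, hθ₁⟩ := exists_cutoff_exponent ϑ G hϑ1 hϑ2 hG1 hG2
  obtain ⟨σ, hσ, hσ'⟩ : ∃ σ : ℝ, 0 < σ ∧
      (σ ≤ ϑ ∧ σ ≤ 2 * δ - 1 + ϑ) ∧ (σ ≤ G * (ϑ - δ) ∧ σ ≤ 1 - ϑ) :=
    ⟨min (min ϑ (2 * δ - 1 + ϑ)) (min (G * (ϑ - δ)) (1 - ϑ)),
      lt_min (lt_min (by linarith) (by linarith))
        (lt_min (mul_pos hG1 (by linarith)) (by linarith)),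
      le_min_iff.1 (min_le_left _ _), le_min_iff.1 (min_le_right _ _)⟩
  obtain ⟨⟨hσ1, hσ2⟩, hσ3, hσ4⟩ := hσ'
  refine ⟨σ / 6, by positivity, fun g hg hyp c₁ c₂ hc₁ hc => ?_⟩
  have hc₂ : 0 < c₂ := hc₁.trans hc
  obtain ⟨K, N₀, hK, hbd⟩ := Jw'_sum_divisors_le_of_large g hg ϑ G δ σ c₁ c₂ hϑ2 hG1 hG2 hδ hδϑ
    hσ hσ1 hσ2 hσ3 hσ4 hc₁ hc fun θ h1 h2 => hyp θ (hθ₁.trans_le h1) h2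
  set F : ℕ → ℕ → ℝ := fun N H => Jw' (fun n => ∑ d ∈ n.divisors, g d) N H with hF
  have hF0 : ∀ N H, 0 ≤ F N H := fun N H => Finset.sum_nonneg fun _ _ => sq_nonneg _
  set T := ∑ N ∈ Finset.range N₀, ∑ H ∈ Finset.range (⌊c₂ * (N : ℝ) ^ ϑ⌋₊ + 1), F N H with hT
  have hT0 : 0 ≤ T := Finset.sum_nonneg fun _ _ => Finset.sum_nonneg fun _ _ => hF0 _ _
  refine ⟨K * c₂ ^ (σ / 2) + T, by positivity, fun N H hN hH h₁ h₂ => ?_⟩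
  have hNR : (1 : ℝ) ≤ N := by exact_mod_cast hN
  have hHR : (1 : ℝ) ≤ H := by exact_mod_cast hH
  have hN0 : (0 : ℝ) < N := by linarith
  have hH0 : (0 : ℝ) < H := by linarith
  rw [show 2 - 3 * (σ / 6) = 2 - σ / 2 by ring]
  rw [add_mul, add_mul]
  rcases le_or_gt N₀ N with h | h
  · have h3 : (N : ℝ) ^ (-(σ / 2)) ≤ c₂ ^ (σ / 2) * (H : ℝ) ^ (-(σ / 2)) := by
      have h4 : (H : ℝ) ≤ c₂ * N := by
        refine h₂.trans (mul_le_mul_of_nonneg_left ?_ hc₂.le)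
        simpa using Real.rpow_le_rpow_of_exponent_le hNR hϑ2.le
      have h5 : (H : ℝ) ^ (σ / 2) ≤ c₂ ^ (σ / 2) * (N : ℝ) ^ (σ / 2) := by
        rw [← Real.mul_rpow hc₂.le hN0.le]
        gcongr
      rw [Real.rpow_neg hN0.le, Real.rpow_neg hH0.le, ← div_eq_mul_inv, inv_eq_one_div,
        div_le_div_iff₀ (by positivity) (by positivity)]
      linarith
    have h6 : (H : ℝ) ^ (2 - σ / 2) = (H : ℝ) ^ 2 * (H : ℝ) ^ (-(σ / 2)) := by
      rw [sub_eq_add_neg, Real.rpow_add hH0]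
      norm_cast
    calc _ ≤ K * N * (H : ℝ) ^ 2 * (N : ℝ) ^ (-(σ / 2)) := hbd N H h hN hH h₁ h₂
      _ ≤ K * N * (H : ℝ) ^ 2 * (c₂ ^ (σ / 2) * (H : ℝ) ^ (-(σ / 2))) := by gcongr
      _ = K * c₂ ^ (σ / 2) * N * (H : ℝ) ^ (2 - σ / 2) := by
        rw [h6]
        ring
      _ ≤ _ := le_add_of_nonneg_right (by positivity)
  · have h3 : F N H ≤ T := by
      refine le_trans ?_ (Finset.single_le_sum
        (f := fun N : ℕ => ∑ H ∈ Finset.range (⌊c₂ * (N : ℝ) ^ ϑ⌋₊ + 1), F N H)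
        (fun _ _ => Finset.sum_nonneg fun _ _ => hF0 _ _) (Finset.mem_range.2 h))
      exact Finset.single_le_sum (f := F N) (fun _ _ => hF0 _ _)
        (Finset.mem_range.2 (Nat.lt_succ_of_le (Nat.le_floor h₂)))
    have h4 : 1 ≤ (N : ℝ) * (H : ℝ) ^ (2 - σ / 2) :=
      one_le_mul_of_one_le_of_one_le hNR (Real.one_le_rpow hHR (by linarith))
    calc _ ≤ T := h3
      _ ≤ T * (N * (H : ℝ) ^ (2 - σ / 2)) := le_mul_of_one_le_right hT0 h4
      _ = T * N * (H : ℝ) ^ (2 - σ / 2) := by ring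
      _ ≤ _ := le_add_of_nonneg_left (by positivity)
end

section
/- Let f : ℕ → ℝ be an arithmetic function, let p_f be a real polynomial of degree c, and set M_f(x,H) = H·p_f(log x) and J_f(N,H) = Σ_{N<x≤2N} |Σ_{x<n≤x+H} f(n) − M_f(x,H)|², with the convention J_f(N,0) = 0. Then there is a constant C, depending only on the polynomial p_f, such that for all integers N ≥ 2 and 1 ≤ h < H ≤ N/2: J_f(N,H) ≤ C·( (H/h)²·J_f(N,h) + J_f(N, H − h·⌊H/h⌋) + H³·( ‖f‖_∞² + (log N)^{2c} ) ), where ‖f‖_∞ = max_{N−H<n≤2N+H} |f(n)| and ⌊·⌋ is the integer part. -/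
/-- The Selberg integral of `f` with analytic mean value `M_f(x,H) = H·p(log x)`. -/
noncomputable def Jf (f : ℕ → ℝ) (p : Polynomial ℝ) (N H : ℕ) : ℝ :=
  ∑ x ∈ Finset.Ioc N (2 * N),
    (∑ n ∈ Finset.Ioc x (x + H), f n - (H : ℝ) * p.eval (Real.log x)) ^ 2

/-- The deviation of the sum of `f` over `(x, x + k]` from the mean value `k * g x`. -/
noncomputable def shortDev (f g : ℕ → ℝ) (k x : ℕ) : ℝ :=
  ∑ n ∈ Finset.Ioc x (x + k), f n - (k : ℝ) * g x

theorem shortDev_add (f g : ℕ → ℝ) (x k l : ℕ) :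
    shortDev f g (k + l) x =
      shortDev f g k x + shortDev f g l (x + k) + (l : ℝ) * (g (x + k) - g x) := by
  unfold shortDev
  rw [← Finset.sum_Ioc_consecutive f (show x ≤ x + k by omega)
    (show x + k ≤ x + (k + l) by omega), ← add_assoc x k l]
  push_cast
  ring

theorem shortDev_mul (f g : ℕ → ℝ) (x h q : ℕ) :
    shortDev f g (h * q) x =
      ∑ j ∈ Finset.range q, shortDev f g h (x + h * j) +
        ∑ j ∈ Finset.range q, (h : ℝ) * (g (x + h * j) - g x) := by
  induction q with
  | zero => simp [shortDev]
  | succ q ih =>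
    rw [mul_add_one, shortDev_add, ih, Finset.sum_range_succ, Finset.sum_range_succ]
    ring

theorem sq_shortDev_le {f g : ℕ → ℝ} {x k : ℕ} {M D : ℝ}
    (hf : ∀ n ∈ Finset.Ioc x (x + k), |f n| ≤ M) (hg : |g x| ≤ D) :
    shortDev f g k x ^ 2 ≤ 2 * (k : ℝ) ^ 2 * (M ^ 2 + D ^ 2) := by
  have h1 : |∑ n ∈ Finset.Ioc x (x + k), f n| ≤ k * M := by
    refine (Finset.abs_sum_le_sum_abs _ _).trans ((Finset.sum_le_card_nsmul _ _ _ hf).trans ?_)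
    simp
  have h2 : (∑ n ∈ Finset.Ioc x (x + k), f n) ^ 2 ≤ (k * M) ^ 2 := sq_le_sq' (abs_le.1 h1).1
    (abs_le.1 h1).2
  have h3 : g x ^ 2 ≤ D ^ 2 := sq_le_sq' (abs_le.1 hg).1 (abs_le.1 hg).2
  have h4 := mul_le_mul_of_nonneg_left h3 (sq_nonneg (k : ℝ))
  unfold shortDev
  nlinarith [sq_nonneg (∑ n ∈ Finset.Ioc x (x + k), f n + (k : ℝ) * g x)]

theorem sum_sq_shortDev_shift_le {f g : ℕ → ℝ} {N H k s : ℕ} {M D : ℝ}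
    (hf : ∀ n ∈ Finset.Ioc (2 * N) (2 * N + H), |f n| ≤ M)
    (hg : ∀ x ∈ Finset.Ioc (2 * N) (2 * N + H), |g x| ≤ D) (hs : s + k ≤ H) :
    ∑ x ∈ Finset.Ioc N (2 * N), shortDev f g k (x + s) ^ 2 ≤
      ∑ x ∈ Finset.Ioc N (2 * N), shortDev f g k x ^ 2 +
        H * (2 * (k : ℝ) ^ 2 * (M ^ 2 + D ^ 2)) := by
  have hshift : ∑ x ∈ Finset.Ioc N (2 * N), shortDev f g k (x + s) ^ 2 =
      ∑ x ∈ Finset.Ioc (N + s) (2 * N + s), shortDev f g k x ^ 2 := by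
    rw [← Finset.map_add_right_Ioc, Finset.sum_map]
    rfl
  have htail : ∑ x ∈ Finset.Ioc (2 * N) (2 * N + s), shortDev f g k x ^ 2 ≤
      H * (2 * (k : ℝ) ^ 2 * (M ^ 2 + D ^ 2)) := by
    refine (Finset.sum_le_card_nsmul _ _ (2 * (k : ℝ) ^ 2 * (M ^ 2 + D ^ 2)) ?_).trans ?_
    · intro x hx
      rw [Finset.mem_Ioc] at hx
      refine sq_shortDev_le (fun n hn => hf n ?_) (hg x ?_)
      · rw [Finset.mem_Ioc] at hn ⊢
        omega
      · rw [Finset.mem_Ioc]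
        omega
    · rw [Nat.card_Ioc, nsmul_eq_mul]
      gcongr
      omega
  rw [hshift]
  refine le_trans ?_ (add_le_add_right htail _)
  rw [Finset.sum_Ioc_consecutive _ (show N ≤ 2 * N by omega) (by omega)]
  exact Finset.sum_le_sum_of_subset_of_nonneg (Finset.Ioc_subset_Ioc (by omega) le_rfl)
    fun _ _ _ => sq_nonneg _

theorem sum_sq_shortDev_le {f g : ℕ → ℝ} {N h H : ℕ} {M D : ℝ} (hN : 0 < N) (hh : 0 < h)
    (hHN : H ≤ N)
    (hf : ∀ n ∈ Finset.Ioc (2 * N) (2 * N + H), |f n| ≤ M)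
    (hg : ∀ x ∈ Finset.Ioc (2 * N) (2 * N + H), |g x| ≤ D)
    (hlip : ∀ x ∈ Finset.Ioc N (2 * N), ∀ k ≤ H, |g (x + k) - g x| ≤ D * (H / N)) :
    ∑ x ∈ Finset.Ioc N (2 * N), shortDev f g H x ^ 2 ≤
      15 * (((H : ℝ) / h) ^ 2 * ∑ x ∈ Finset.Ioc N (2 * N), shortDev f g h x ^ 2 +
        ∑ x ∈ Finset.Ioc N (2 * N), shortDev f g (H - h * (H / h)) x ^ 2 +
        (H : ℝ) ^ 3 * (M ^ 2 + D ^ 2)) := by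
  set q := H / h
  set r := H - h * q
  have hqH : h * q ≤ H := Nat.mul_div_le H h
  have hHr : h * q + r = H := by omega
  have hHrR : (h : ℝ) * q + r = H := by exact_mod_cast hHr
  have hNR : (0 : ℝ) < N := by exact_mod_cast hN
  have hhR : (0 : ℝ) < h := by exact_mod_cast hh
  have hHNR : (H : ℝ) ≤ N := by exact_mod_cast hHN
  have hqR : (q : ℝ) ≤ H / h := by
    rw [le_div_iff₀ hhR]
    have : (0 : ℝ) ≤ r := by positivity
    linarith
  have hpoint : ∀ x ∈ Finset.Ioc N (2 * N), shortDev f g H x ^ 2 ≤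
      3 * (q * ∑ j ∈ Finset.range q, shortDev f g h (x + h * j) ^ 2 +
        shortDev f g r (x + h * q) ^ 2 + (H * (D * (H / N))) ^ 2) := by
    intro x hx
    have hsplit := shortDev_add f g x (h * q) r
    rw [hHr, shortDev_mul] at hsplit
    have hcs := sq_sum_le_card_mul_sum_sq (s := Finset.range q)
      (f := fun j => shortDev f g h (x + h * j))
    rw [Finset.card_range] at hcs
    have hcorr : |∑ j ∈ Finset.range q, (h : ℝ) * (g (x + h * j) - g x) +
        r * (g (x + h * q) - g x)| ≤ H * (D * (H / N)) := by
      have h1 : |∑ j ∈ Finset.range q, (h : ℝ) * (g (x + h * j) - g x)| ≤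
          q * (h * (D * (H / N))) := by
        refine (Finset.abs_sum_le_sum_abs _ _).trans
          ((Finset.sum_le_card_nsmul _ _ (h * (D * (H / N))) ?_).trans ?_)
        · intro j hj
          rw [abs_mul, Nat.abs_cast]
          refine mul_le_mul_of_nonneg_left (hlip x hx _ ?_) hhR.le
          exact (Nat.mul_le_mul_left h (Finset.mem_range.1 hj).le).trans hqH
        · simp
      have h2 : |(r : ℝ) * (g (x + h * q) - g x)| ≤ r * (D * (H / N)) := by
        rw [abs_mul, Nat.abs_cast]
        exact mul_le_mul_of_nonneg_left (hlip x hx _ hqH) (Nat.cast_nonneg r)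
      refine (abs_add_le _ _).trans ((add_le_add h1 h2).trans (le_of_eq ?_))
      rw [← hHrR]
      ring
    have hcorr2 := sq_le_sq' (abs_le.1 hcorr).1 (abs_le.1 hcorr).2
    rw [hsplit]
    set a := ∑ j ∈ Finset.range q, shortDev f g h (x + h * j)
    set b := shortDev f g r (x + h * q)
    set c₁ := ∑ j ∈ Finset.range q, (h : ℝ) * (g (x + h * j) - g x)
    set c₂ := (r : ℝ) * (g (x + h * q) - g x)
    nlinarith [sq_nonneg (a - b), sq_nonneg (a - (c₁ + c₂)), sq_nonneg (b - (c₁ + c₂))]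
  have hsum := Finset.sum_le_sum hpoint
  rw [← Finset.mul_sum, Finset.sum_add_distrib, Finset.sum_add_distrib, ← Finset.mul_sum,
    Finset.sum_comm, Finset.sum_const, Nat.card_Ioc, nsmul_eq_mul,
    show 2 * N - N = N by omega] at hsum
  set Jh := ∑ x ∈ Finset.Ioc N (2 * N), shortDev f g h x ^ 2
  set Jr := ∑ x ∈ Finset.Ioc N (2 * N), shortDev f g r x ^ 2
  have hJh : 0 ≤ Jh := Finset.sum_nonneg fun _ _ => sq_nonneg _
  have hJr : 0 ≤ Jr := Finset.sum_nonneg fun _ _ => sq_nonneg _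
  have hmain : ∑ j ∈ Finset.range q, ∑ x ∈ Finset.Ioc N (2 * N), shortDev f g h (x + h * j) ^ 2 ≤
      q * (Jh + H * (2 * (h : ℝ) ^ 2 * (M ^ 2 + D ^ 2))) := by
    refine (Finset.sum_le_card_nsmul _ _ (Jh + H * (2 * (h : ℝ) ^ 2 * (M ^ 2 + D ^ 2))) ?_).trans
      (by rw [Finset.card_range, nsmul_eq_mul])
    intro j hj
    refine sum_sq_shortDev_shift_le hf hg ?_
    have := Nat.mul_le_mul_left h (Finset.mem_range.1 hj)
    rw [Nat.mul_succ] at this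
    omega
  have hrem := sum_sq_shortDev_shift_le (N := N) (k := r) hf hg (s := h * q) hHr.le
  have h1 : (q : ℝ) * (q * (Jh + H * (2 * (h : ℝ) ^ 2 * (M ^ 2 + D ^ 2)))) ≤
      ((H : ℝ) / h) ^ 2 * Jh + 2 * ((H : ℝ) ^ 3 * (M ^ 2 + D ^ 2)) := by
    calc (q : ℝ) * (q * (Jh + H * (2 * (h : ℝ) ^ 2 * (M ^ 2 + D ^ 2))))
        = (q : ℝ) ^ 2 * (Jh + H * (2 * (h : ℝ) ^ 2 * (M ^ 2 + D ^ 2))) := by ring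
      _ ≤ ((H : ℝ) / h) ^ 2 * (Jh + H * (2 * (h : ℝ) ^ 2 * (M ^ 2 + D ^ 2))) := by gcongr
      _ = _ := by field_simp
  have h2 : (H : ℝ) * (2 * (r : ℝ) ^ 2 * (M ^ 2 + D ^ 2)) ≤
      2 * ((H : ℝ) ^ 3 * (M ^ 2 + D ^ 2)) := by
    have hrH : (r : ℝ) ≤ H := by exact_mod_cast (show r ≤ H by omega)
    calc (H : ℝ) * (2 * (r : ℝ) ^ 2 * (M ^ 2 + D ^ 2))
        ≤ (H : ℝ) * (2 * (H : ℝ) ^ 2 * (M ^ 2 + D ^ 2)) := by gcongr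
      _ = _ := by ring
  have h3 : (N : ℝ) * (H * (D * (H / N))) ^ 2 ≤ (H : ℝ) ^ 3 * (M ^ 2 + D ^ 2) := by
    calc (N : ℝ) * (H * (D * (H / N))) ^ 2 = (H : ℝ) ^ 3 * D ^ 2 * (H / N) := by field_simp
      _ ≤ (H : ℝ) ^ 3 * D ^ 2 * 1 := by
        gcongr
        exact (div_le_one hNR).2 hHNR
      _ ≤ (H : ℝ) ^ 3 * (M ^ 2 + D ^ 2) := by
        rw [mul_one]
        gcongr
        exact le_add_of_nonneg_left (sq_nonneg M)
  have h4 := (mul_le_mul_of_nonneg_left hmain (Nat.cast_nonneg q)).trans h1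
  have h5 : 0 ≤ ((H : ℝ) / h) ^ 2 * Jh := by positivity
  linarith

theorem Polynomial.exists_abs_eval_le_mul_pow (p : Polynomial ℝ) {c : ℕ} (hc : p.natDegree ≤ c) :
    ∃ A : ℝ, 0 ≤ A ∧ ∀ L u : ℝ, 1 / 2 ≤ L → |u| ≤ 3 * L → |p.eval u| ≤ A * L ^ c := by
  refine ⟨∑ i ∈ Finset.range (p.natDegree + 1), |p.coeff i| * (3 ^ i * 2 ^ (c - i)),
    Finset.sum_nonneg fun _ _ => by positivity, fun L u hL hu => ?_⟩
  rw [Polynomial.eval_eq_sum_range, Finset.sum_mul]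
  refine (Finset.abs_sum_le_sum_abs _ _).trans (Finset.sum_le_sum fun i hi => ?_)
  have hic : i ≤ c := by
    rw [Finset.mem_range] at hi
    omega
  rw [abs_mul, abs_pow, mul_assoc]
  refine mul_le_mul_of_nonneg_left ?_ (abs_nonneg _)
  have hone : 1 ≤ (2 * L) ^ (c - i) := one_le_pow₀ (by linarith)
  calc |u| ^ i ≤ (3 * L) ^ i := by gcongr
    _ ≤ (3 * L) ^ i * (2 * L) ^ (c - i) := le_mul_of_one_le_right (by positivity) hone
    _ = 3 ^ i * 2 ^ (c - i) * (L ^ i * L ^ (c - i)) := by rw [mul_pow, mul_pow]; ring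
    _ = 3 ^ i * 2 ^ (c - i) * L ^ c := by rw [← pow_add, Nat.add_sub_cancel' hic]

theorem Polynomial.exists_eval_log_bounds (p : Polynomial ℝ) :
    ∃ A : ℝ, 0 ≤ A ∧ ∀ N : ℕ, 2 ≤ N → ∀ x : ℕ, N ≤ x → x ≤ 3 * N →
      |p.eval (Real.log x)| ≤ A * Real.log N ^ p.natDegree ∧
      ∀ y : ℕ, x ≤ y → y ≤ 3 * N → |p.eval (Real.log y) - p.eval (Real.log x)| ≤
        A * Real.log N ^ p.natDegree * (((y : ℝ) - x) / N) := by
  obtain ⟨A, hA, hpA⟩ := p.exists_abs_eval_le_mul_pow le_rfl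
  obtain ⟨B, hB, hpB⟩ := p.derivative.exists_abs_eval_le_mul_pow
    (p.natDegree_derivative_le.trans (Nat.sub_le _ 1))
  refine ⟨A + B, add_nonneg hA hB, fun N hN x hNx hx => ?_⟩
  have hNR : (2 : ℝ) ≤ N := by exact_mod_cast hN
  have hL : 1 / 2 ≤ Real.log N :=
    (by linarith [Real.log_two_gt_d9] : 1 / 2 ≤ Real.log 2).trans
      (Real.log_le_log two_pos hNR)
  have hLc : 0 ≤ Real.log N ^ p.natDegree := by positivity
  have hlog : ∀ y : ℕ, N ≤ y → y ≤ 3 * N → Real.log y ∈ Set.Icc 0 (3 * Real.log N) := by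
    intro y h1 h2
    have h1R : (N : ℝ) ≤ y := by exact_mod_cast h1
    have h2R : (y : ℝ) ≤ 3 * N := by exact_mod_cast h2
    refine ⟨Real.log_nonneg (by linarith), ?_⟩
    rw [show (3 : ℝ) * Real.log N = Real.log ((N : ℝ) ^ 3) by rw [Real.log_pow]; norm_num]
    refine Real.log_le_log (by linarith) ?_
    nlinarith [mul_nonneg (by linarith : (0 : ℝ) ≤ N) (by nlinarith : (0 : ℝ) ≤ (N : ℝ) ^ 2 - 3)]
  have habs : ∀ u ∈ Set.Icc 0 (3 * Real.log N), |u| ≤ 3 * Real.log N := fun u hu => by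
    rw [abs_of_nonneg hu.1]
    exact hu.2
  refine ⟨(hpA _ _ hL (habs _ (hlog x hNx hx))).trans (by gcongr; linarith), fun y hxy hy => ?_⟩
  have hmv := (convex_Icc 0 (3 * Real.log N)).norm_image_sub_le_of_norm_hasDerivWithin_le
    (f := fun u => p.eval u) (fun u _ => (p.hasDerivAt u).hasDerivWithinAt)
    (fun u hu => hpB _ u hL (habs u hu)) (hlog x hNx hx) (hlog y (hNx.trans hxy) hy)
  rw [Real.norm_eq_abs, Real.norm_eq_abs] at hmv
  have hNxR : (N : ℝ) ≤ x := by exact_mod_cast hNx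
  have hxyR : (x : ℝ) ≤ y := by exact_mod_cast hxy
  have hx0 : (0 : ℝ) < x := by linarith
  have hdiff : |Real.log y - Real.log x| ≤ ((y : ℝ) - x) / N := by
    rw [abs_of_nonneg (sub_nonneg.2 (Real.log_le_log hx0 hxyR)),
      ← Real.log_div (by linarith) hx0.ne']
    calc Real.log ((y : ℝ) / x) ≤ (y : ℝ) / x - 1 :=
          Real.log_le_sub_one_of_pos (div_pos (by linarith) hx0)
      _ = ((y : ℝ) - x) / x := by field_simp
      _ ≤ ((y : ℝ) - x) / N :=
          div_le_div_of_nonneg_left (sub_nonneg.2 hxyR) (by linarith) hNxR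
  refine hmv.trans (mul_le_mul ?_ hdiff (abs_nonneg _) (by positivity))
  gcongr
  linarith

theorem stmt6 (p : Polynomial ℝ) :
    ∃ C : ℝ, 0 < C ∧
      ∀ (f : ℕ → ℝ) (N h H : ℕ) (_hN : 2 ≤ N) (_hh : 1 ≤ h) (_hhH : h < H)
        (_hHN : H ≤ N / 2),
        Jf f p N H ≤
          C * (((H : ℝ) / (h : ℝ)) ^ 2 * Jf f p N h + Jf f p N (H - h * (H / h)) +
            (H : ℝ) ^ 3 *
              (((Finset.Ioc (N - H) (2 * N + H)).sup'
                  (Finset.nonempty_Ioc.mpr (by omega)) (fun n => |f n|)) ^ 2 +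
                Real.log N ^ (2 * p.natDegree))) := by
  obtain ⟨A, hA, hlog⟩ := p.exists_eval_log_bounds
  refine ⟨15 * (1 + A ^ 2), by positivity, fun f N h H hN hh hhH hHN => ?_⟩
  set M := (Finset.Ioc (N - H) (2 * N + H)).sup' (Finset.nonempty_Ioc.mpr (by omega))
    fun n => |f n|
  have hf : ∀ n ∈ Finset.Ioc (2 * N) (2 * N + H), |f n| ≤ M := fun n hn =>
    Finset.le_sup' (fun n => |f n|) (Finset.Ioc_subset_Ioc (by omega) le_rfl hn)
  have hbound := sum_sq_shortDev_le (f := f) (g := fun x => p.eval (Real.log x)) (N := N) (h := h)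
    (H := H) (M := M) (D := A * Real.log N ^ p.natDegree) (by omega) hh (by omega) hf
    (fun x hx => by
      rw [Finset.mem_Ioc] at hx
      exact (hlog N hN x (by omega) (by omega)).1)
    (fun x hx k hk => by
      rw [Finset.mem_Ioc] at hx
      refine ((hlog N hN x (by omega) (by omega)).2 (x + k) (by omega) (by omega)).trans ?_
      have : (0 : ℝ) ≤ Real.log N ^ p.natDegree := pow_nonneg (Real.log_natCast_nonneg N) _
      gcongr
      push_cast
      rw [add_sub_cancel_left]
      exact_mod_cast hk)
  change Jf f p N H ≤ 15 * (((H : ℝ) / h) ^ 2 * Jf f p N h + Jf f p N (H - h * (H / h)) +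
    (H : ℝ) ^ 3 * (M ^ 2 + (A * Real.log N ^ p.natDegree) ^ 2)) at hbound
  have hJh : 0 ≤ ((H : ℝ) / h) ^ 2 * Jf f p N h :=
    mul_nonneg (sq_nonneg _) (Finset.sum_nonneg fun _ _ => sq_nonneg _)
  have hJr : 0 ≤ Jf f p N (H - h * (H / h)) := Finset.sum_nonneg fun _ _ => sq_nonneg _
  refine hbound.trans ?_
  rw [mul_pow, ← pow_mul, mul_comm p.natDegree 2, mul_assoc 15]
  have hL : 0 ≤ Real.log N ^ (2 * p.natDegree) := pow_nonneg (Real.log_natCast_nonneg N) _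
  have h1 := mul_nonneg (sq_nonneg A) (add_nonneg hJh hJr)
  have h2 : 0 ≤ (H : ℝ) ^ 3 * (A ^ 2 * M ^ 2 + Real.log N ^ (2 * p.natDegree)) := by positivity
  linarith
end
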